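/- arXiv:2501.07310 — 3 statements merged into one kernel-verified Lean document; each statement's English description precedes it below -/
import Mathlib

section
/- Let U and V be modules in mod A with the same Newton polytope, N(U) = N(V). Then for every τ-rigid module M in mod A (in particular, for the module M of any τ-tilting pair (M,P)), U belongs to Fac M if and only if V belongs to Fac M. -/
/-! Common definitions: finite-dimensional modules over a finite-dimensional algebra,
quotient modules, dimension vectors via composition series, Newton polytopes,
torsion classes, `Fac`, τ-rigidity, bricks, etc. -/

variable (A : Type) [Ring A]

/-- `X` is a quotient module of `M`. -/
def IsQuotientOf (M X : ModuleCat.{0} A) : Prop :=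
  ∃ f : M →ₗ[A] X, Function.Surjective f

open Classical in
/-- The dimension vector of a module `M`, relative to a family `S : Fin n → ModuleCat A`
of (representatives of the isomorphism classes of the) simple `A`-modules: its `i`-th entry
is the multiplicity of `S i` as a composition factor of `M` (well defined by Jordan–Hölder,
for `M` of finite length). -/
noncomputable def dimVec {n : ℕ} (S : Fin n → ModuleCat.{0} A)
    (M : Type) [AddCommGroup M] [Module A M] : Fin n → ℕ := fun i =>
  if h : ∃ s : CompositionSeries (Submodule A M),
      RelSeries.head s = ⊥ ∧ RelSeries.last s = ⊤ then
    Nat.card {j : Fin h.choose.length //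
      Nonempty ((↥(h.choose j.succ) ⧸
        (Submodule.comap (h.choose j.succ).subtype
          (h.choose j.castSucc))) ≃ₗ[A] S i)}
  else 0

/-- The Newton polytope of `U`: the convex hull in `ℝⁿ` of the dimension vectors of
the quotient modules of `U`. -/
noncomputable def newtonPolytope {n : ℕ} (S : Fin n → ModuleCat.{0} A)
    (U : ModuleCat.{0} A) : Set (Fin n → ℝ) :=
  convexHull ℝ { v : Fin n → ℝ | ∃ p : Submodule A U,
    v = fun i => ((dimVec A S (↥U ⧸ p) i : ℕ) : ℝ) }

/-- `Fac M`: the class of quotient modules of finite direct sums of copies of `M`. -/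
def Fac (M : ModuleCat.{0} A) : Set (ModuleCat.{0} A) :=
  { X | ∃ (k : ℕ) (f : (Fin k → M) →ₗ[A] X), Function.Surjective f }

/-- A torsion class in `mod A`: a class of finite-dimensional `A`-modules closed under
isomorphisms, quotient modules and extensions. -/
def IsTorsionClass (T : Set (ModuleCat.{0} A)) : Prop :=
  (∀ M ∈ T, Module.Finite A M) ∧
  (∀ M ∈ T, ∀ N : ModuleCat.{0} A, Nonempty (M ≃ₗ[A] N) → N ∈ T) ∧
  (∀ M ∈ T, ∀ X : ModuleCat.{0} A, IsQuotientOf A M X → X ∈ T) ∧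
  (∀ (L E N : ModuleCat.{0} A) (f : L →ₗ[A] E) (g : E →ₗ[A] N),
    Function.Injective f → Function.Surjective g →
    LinearMap.range f = LinearMap.ker g → L ∈ T → N ∈ T → E ∈ T)

/-- `⟨N⟩_tors`, the smallest torsion class containing `N`. -/
def torsGen (N : ModuleCat.{0} A) : Set (ModuleCat.{0} A) :=
  ⋂₀ { T | IsTorsionClass A T ∧ N ∈ T }

/-- A module `N` is left finite if the torsion class it generates is functorially finite,
i.e. `⟨N⟩_tors = Fac M` for some `M` in `mod A`. -/
def LeftFinite (N : ModuleCat.{0} A) : Prop :=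
  ∃ M : ModuleCat.{0} A, Module.Finite A M ∧ torsGen A N = Fac A M

/-- `M` is τ-rigid: `Ext¹(M, X) = 0` for every `X ∈ Fac M`, expressed by the splitting of
every short exact sequence `0 → X → E → M → 0`. -/
def IsTauRigid (M : ModuleCat.{0} A) : Prop :=
  ∀ X ∈ Fac A M, ∀ (E : ModuleCat.{0} A) (f : X →ₗ[A] E) (g : E →ₗ[A] M),
    Function.Injective f → Function.Surjective g → LinearMap.range f = LinearMap.ker g →
    ∃ s : M →ₗ[A] E, g.comp s = LinearMap.id

/-- `M` is indecomposable. -/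
def Indecomposable (M : ModuleCat.{0} A) : Prop :=
  Nontrivial M ∧ ∀ (M₁ M₂ : ModuleCat.{0} A),
    Nonempty (M ≃ₗ[A] (M₁ × M₂)) → (Subsingleton M₁ ∨ Subsingleton M₂)

/-- `M` is a brick: its endomorphism ring is a division ring, i.e. `M ≠ 0` and every
nonzero endomorphism of `M` is invertible. -/
def IsBrick (M : ModuleCat.{0} A) : Prop :=
  Nontrivial M ∧ ∀ f : M →ₗ[A] M, f ≠ 0 → Function.Bijective f

section HomDimension

variable {A} {K : Type} [Field K] [Algebra K A]

/-- Postcomposition with an `A`-linear map, as a `K`-linear map between spaces of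
`A`-linear maps. -/
def postcompHom (N : Type) [AddCommGroup N] [Module A N] {X Y : Type} [AddCommGroup X]
    [Module A X] [Module K X] [IsScalarTower K A X] [AddCommGroup Y] [Module A Y] [Module K Y]
    [IsScalarTower K A Y] (g : X →ₗ[A] Y) : (N →ₗ[A] X) →ₗ[K] (N →ₗ[A] Y) where
  toFun f := g ∘ₗ f
  map_add' f f' := LinearMap.comp_add f f' g
  map_smul' c f := by ext x; simp [LinearMap.map_smul_of_tower]

/-- Precomposition with an `A`-linear map, as a `K`-linear map between spaces of
`A`-linear maps. -/
def precompHom {N P : Type} [AddCommGroup N] [Module A N] [AddCommGroup P] [Module A P]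
    (i : N →ₗ[A] P) (X : Type) [AddCommGroup X] [Module A X] [Module K X] [IsScalarTower K A X] :
    (P →ₗ[A] X) →ₗ[K] (N →ₗ[A] X) where
  toFun f := f ∘ₗ i
  map_add' f f' := LinearMap.add_comp i f' f
  map_smul' c f := by ext x; simp

variable {N : Type} [AddCommGroup N] [Module A N]
variable {X : Type} [AddCommGroup X] [Module A X] [Module K X] [IsScalarTower K A X]

lemma finite_hom [Module K N] [IsScalarTower K A N] [Module.Finite K N] [Module.Finite K X] :
    Module.Finite K (N →ₗ[A] X) := by
  let r : (N →ₗ[A] X) →ₗ[K] (N →ₗ[K] X) :=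
    { toFun f := f.restrictScalars K
      map_add' _ _ := rfl
      map_smul' _ _ := rfl }
  exact Module.Finite.of_injective r (LinearMap.restrictScalars_injective K)

lemma finrank_hom_congr {Y : Type} [AddCommGroup Y] [Module A Y] [Module K Y]
    [IsScalarTower K A Y] (e : X ≃ₗ[A] Y) :
    Module.finrank K (N →ₗ[A] X) = Module.finrank K (N →ₗ[A] Y) := by
  refine LinearEquiv.finrank_eq (LinearEquiv.ofBijective (postcompHom N e.toLinearMap) ⟨?_, ?_⟩)
  · intro f f' h
    ext x
    exact e.injective (LinearMap.congr_fun h x)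
  · intro f
    exact ⟨e.symm.toLinearMap ∘ₗ f, by ext x; simp [postcompHom]⟩

lemma finrank_hom_eq_add_finrank_range {L Y : Type} [AddCommGroup L] [Module A L] [Module K L]
    [IsScalarTower K A L] [AddCommGroup Y] [Module A Y] [Module K Y] [IsScalarTower K A Y]
    [Module.Finite K (N →ₗ[A] X)]
    (j : L →ₗ[A] X) (g : X →ₗ[A] Y) (hj : Function.Injective j)
    (hjg : LinearMap.range j = LinearMap.ker g) :
    Module.finrank K (N →ₗ[A] X) = Module.finrank K (N →ₗ[A] L) +
      Module.finrank K (LinearMap.range (postcompHom (K := K) N g)) := by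
  have hinj : Function.Injective (postcompHom (K := K) N j) := fun f f' h => by
    ext x
    exact hj (LinearMap.congr_fun h x)
  have hker : LinearMap.ker (postcompHom (K := K) N g) =
      LinearMap.range (postcompHom (K := K) N j) := by
    ext f
    constructor
    · intro hf
      have hmem : ∀ x, f x ∈ LinearMap.range j := fun x => by
        rw [hjg]
        exact LinearMap.congr_fun hf x
      refine ⟨(LinearEquiv.ofInjective j hj).symm.toLinearMap ∘ₗ
        f.codRestrict (LinearMap.range j) hmem, ?_⟩
      ext x
      exact congrArg Subtype.val
        ((LinearEquiv.ofInjective j hj).apply_symm_apply ⟨f x, hmem x⟩)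
    · rintro ⟨f', rfl⟩
      ext x
      have : j (f' x) ∈ LinearMap.ker g := hjg ▸ LinearMap.mem_range_self j _
      exact this
  rw [← LinearMap.finrank_range_add_finrank_ker (postcompHom (K := K) N g), hker,
    LinearMap.finrank_range_of_inj hinj, add_comm]

/-- `Hom(N, -)` is exact on the sequences `0 → q / p → X / p → X / q → 0`. -/
def HomExactOn (A : Type) [Ring A] (N X : Type) [AddCommGroup N] [Module A N]
    [AddCommGroup X] [Module A X] : Prop :=
  ∀ (p q : Submodule A X) (hpq : p ≤ q) (f : N →ₗ[A] X ⧸ q),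
    ∃ f' : N →ₗ[A] X ⧸ p, Submodule.factor hpq ∘ₗ f' = f

variable [Module.Finite K X] [Module K N] [IsScalarTower K A N] [Module.Finite K N]

lemma finrank_hom_quotient (p q : Submodule A X) (hpq : p ≤ q) :
    Module.finrank K (N →ₗ[A] X ⧸ p) ≤
        Module.finrank K (N →ₗ[A] (q ⧸ p.comap q.subtype)) +
          Module.finrank K (N →ₗ[A] X ⧸ q) ∧
      (HomExactOn A N X → Module.finrank K (N →ₗ[A] X ⧸ p) =
        Module.finrank K (N →ₗ[A] (q ⧸ p.comap q.subtype)) +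
          Module.finrank K (N →ₗ[A] X ⧸ q)) := by
  have : Module.Finite K (X ⧸ p) :=
    Module.Finite.of_surjective (p.mkQ.restrictScalars K) p.mkQ_surjective
  have : Module.Finite K (X ⧸ q) :=
    Module.Finite.of_surjective (q.mkQ.restrictScalars K) q.mkQ_surjective
  have : Module.Finite K (N →ₗ[A] X ⧸ p) := finite_hom
  have : Module.Finite K (N →ₗ[A] X ⧸ q) := finite_hom
  let j : (q ⧸ p.comap q.subtype) →ₗ[A] X ⧸ p := Submodule.mapQ _ p q.subtype le_rfl
  have hj : Function.Injective j := by
    rw [← LinearMap.ker_eq_bot, Submodule.ker_mapQ, ← LinearMap.le_ker_iff_map,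
      Submodule.ker_mkQ]
  have hjg : LinearMap.range j = LinearMap.ker (Submodule.factor hpq) := by
    ext y
    obtain ⟨x, rfl⟩ := p.mkQ_surjective y
    constructor
    · rintro ⟨z, hz⟩
      obtain ⟨w, rfl⟩ := Submodule.mkQ_surjective _ z
      rw [← hz]
      change Submodule.Quotient.mk (w : X) = (0 : X ⧸ q)
      exact (Submodule.Quotient.mk_eq_zero q).2 w.2
    · intro hx
      exact ⟨Submodule.Quotient.mk ⟨x, (Submodule.Quotient.mk_eq_zero q).1 hx⟩, rfl⟩
  have key := finrank_hom_eq_add_finrank_range (K := K) (N := N) j _ hj hjg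
  refine ⟨?_, fun hex => ?_⟩
  · rw [key]
    gcongr
    exact Submodule.finrank_le _
  · have : LinearMap.range (postcompHom (K := K) N (Submodule.factor hpq)) = ⊤ :=
      LinearMap.range_eq_top.2 (hex p q hpq)
    rw [key, this, finrank_top]

lemma finrank_hom_compositionSeries (s : CompositionSeries (Submodule A X))
    (h0 : s.head = ⊥) (h1 : s.last = ⊤) :
    Module.finrank K (N →ₗ[A] X) ≤ ∑ j : Fin s.length, Module.finrank K
        (N →ₗ[A] (s j.succ ⧸ (s j.castSucc).comap (s j.succ).subtype)) ∧
      (HomExactOn A N X → Module.finrank K (N →ₗ[A] X) = ∑ j : Fin s.length, Module.finrank K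
        (N →ₗ[A] (s j.succ ⧸ (s j.castSucc).comap (s j.succ).subtype))) := by
  have hstep (j : Fin s.length) := finrank_hom_quotient (K := K) (N := N)
    (s j.castSucc) (s j.succ) (s.step j).le
  set a : Fin (s.length + 1) → ℕ := fun i => Module.finrank K (N →ₗ[A] X ⧸ s i) with ha
  have hfirst : a 0 = Module.finrank K (N →ₗ[A] X) :=
    finrank_hom_congr (Submodule.quotEquivOfEqBot _ h0)
  have hlast : a (Fin.last _) = 0 := by
    have : Subsingleton (X ⧸ s (Fin.last _)) := Submodule.Quotient.subsingleton_iff.2 h1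
    have : Subsingleton (N →ₗ[A] X ⧸ s (Fin.last _)) :=
      ⟨fun f f' => by ext x; exact Subsingleton.elim _ _⟩
    exact Module.finrank_zero_of_subsingleton
  have hsum := (Fin.sum_univ_succ a).symm.trans (Fin.sum_univ_castSucc a)
  rw [hfirst, hlast, add_zero] at hsum
  refine ⟨?_, fun hex => ?_⟩
  · have := Finset.sum_le_sum fun j (_ : j ∈ Finset.univ) => (hstep j).1
    rw [Finset.sum_add_distrib] at this
    change ∑ j : Fin s.length, a j.castSucc ≤ _ + ∑ j : Fin s.length, a j.succ at this
    omega
  · have := Finset.sum_congr rfl fun j (_ : j ∈ Finset.univ) => (hstep j).2 hex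
    rw [Finset.sum_add_distrib] at this
    change ∑ j : Fin s.length, a j.castSucc = _ + ∑ j : Fin s.length, a j.succ at this
    omega

/-- The dimension of `Hom(N, X)` is bounded by its value on the composition factors of `X`,
with equality when `Hom(N, -)` is exact on `X`. -/
lemma finrank_hom_dimVec [FiniteDimensional K A] {n : ℕ} (S : Fin n → ModuleCat.{0} A)
    [∀ i, Module K (S i)] [∀ i, IsScalarTower K A (S i)]
    (hdistinct : ∀ i j, Nonempty ((S i : Type) ≃ₗ[A] (S j : Type)) → i = j)
    (hcomplete : ∀ M : ModuleCat.{0} A, IsSimpleModule A M → ∃ i, Nonempty (M ≃ₗ[A] S i)) :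
    Module.finrank K (N →ₗ[A] X) ≤
        ∑ i, dimVec A S X i * Module.finrank K (N →ₗ[A] S i) ∧
      (HomExactOn A N X → Module.finrank K (N →ₗ[A] X) =
        ∑ i, dimVec A S X i * Module.finrank K (N →ₗ[A] S i)) := by
  classical
  have : IsNoetherian A X := isNoetherian_of_tower K inferInstance
  have : IsArtinian A X := isArtinian_of_tower K inferInstance
  have h := exists_compositionSeries_of_isNoetherian_isArtinian A X
  obtain ⟨s, hs⟩ : ∃ s, s = h.choose := ⟨_, rfl⟩
  have hspec := h.choose_spec
  have hdim (i : Fin n) : dimVec A S X i = Nat.card {j : Fin s.length //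
      Nonempty ((s j.succ ⧸ (s j.castSucc).comap (s j.succ).subtype) ≃ₗ[A] S i)} := by
    subst hs
    exact dif_pos h
  rw [← hs] at hspec
  have hiso (j : Fin s.length) : ∃ i, Nonempty
      ((s j.succ ⧸ (s j.castSucc).comap (s j.succ).subtype) ≃ₗ[A] S i) :=
    hcomplete (ModuleCat.of A _) ((covBy_iff_quot_is_simple (s.step j).le).1 (s.step j))
  choose t ht using hiso
  have hcard (i : Fin n) : dimVec A S X i = (Finset.univ.filter (t · = i)).card := by
    rw [hdim, Nat.card_eq_fintype_card, Fintype.card_subtype]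
    congr 1
    ext j
    simp only [Finset.mem_filter, Finset.mem_univ, true_and]
    constructor
    · rintro ⟨e⟩
      exact hdistinct _ _ ⟨(ht j).some.symm.trans e⟩
    · rintro rfl
      exact ht j
  have hsum : ∑ i, dimVec A S X i * Module.finrank K (N →ₗ[A] S i) =
      ∑ j : Fin s.length, Module.finrank K
        (N →ₗ[A] (s j.succ ⧸ (s j.castSucc).comap (s j.succ).subtype)) := by
    rw [← Finset.sum_fiberwise Finset.univ t]
    refine Finset.sum_congr rfl fun i _ => ?_
    rw [hcard, ← smul_eq_mul, ← Finset.sum_const]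
    refine Finset.sum_congr rfl fun j hj => ?_
    obtain rfl := (Finset.mem_filter.1 hj).2
    exact (finrank_hom_congr (ht j).some).symm
  rw [hsum]
  exact finrank_hom_compositionSeries s hspec.1 hspec.2

lemma homExactOn_of_projective [Module.Projective A N] : HomExactOn A N X := fun _ _ hpq f =>
  Module.projective_lifting_property (Submodule.factor hpq) f (Submodule.factor_surjective hpq)

end HomDimension

section TauRigid

variable {A}

lemma Fac.of_surjective {M X Y : ModuleCat.{0} A} (hX : X ∈ Fac A M) (g : X →ₗ[A] Y)
    (hg : Function.Surjective g) : Y ∈ Fac A M := by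
  obtain ⟨k, f, hf⟩ := hX
  exact ⟨k, g ∘ₗ f, hg.comp hf⟩

lemma exists_hom_ne_zero_of_mem_Fac {M X : ModuleCat.{0} A} (hX : X ∈ Fac A M)
    [Nontrivial X] : ∃ f : M →ₗ[A] X, f ≠ 0 := by
  obtain ⟨k, f, hf⟩ := hX
  by_contra! h
  obtain ⟨x, hx⟩ := exists_ne (0 : X)
  obtain ⟨y, rfl⟩ := hf x
  have : f = 0 := LinearMap.pi_ext' fun i => by rw [h (f ∘ₗ _), LinearMap.zero_comp]
  exact hx (by rw [this, LinearMap.zero_apply])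

lemma IsTauRigid.extend {M : ModuleCat.{0} A} (hM : IsTauRigid A M) {P : Type}
    [AddCommGroup P] [Module A P] (π : P →ₗ[A] M) (hπ : Function.Surjective π)
    {X : ModuleCat.{0} A} (hX : X ∈ Fac A M) (f : LinearMap.ker π →ₗ[A] X) :
    ∃ h : P →ₗ[A] X, h ∘ₗ (LinearMap.ker π).subtype = f := by
  let R : Submodule A (X × P) := LinearMap.range (f.prod (-(LinearMap.ker π).subtype))
  have hR : R ≤ LinearMap.ker (π ∘ₗ LinearMap.snd A X P) := by
    rintro _ ⟨w, rfl⟩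
    simp
  let ι : X →ₗ[A] (X × P) ⧸ R := R.mkQ ∘ₗ LinearMap.inl A X P
  let g : ((X × P) ⧸ R) →ₗ[A] M := R.liftQ _ hR
  have hι : Function.Injective ι := by
    rw [← LinearMap.ker_eq_bot, LinearMap.ker_eq_bot']
    intro x hx
    obtain ⟨w, hw⟩ := (Submodule.Quotient.mk_eq_zero R).1 hx
    obtain ⟨h1, h2⟩ := Prod.ext_iff.1 hw
    have : w = 0 := by ext; simpa using h2
    simpa [this] using h1.symm
  have hg : Function.Surjective g := fun m => by
    obtain ⟨p, rfl⟩ := hπ m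
    exact ⟨R.mkQ (0, p), rfl⟩
  have hex : LinearMap.range ι = LinearMap.ker g := by
    ext y
    constructor
    · rintro ⟨x, rfl⟩
      exact map_zero π
    · obtain ⟨⟨x, p⟩, rfl⟩ := R.mkQ_surjective y
      intro hp
      have hp : p ∈ LinearMap.ker π := hp
      refine ⟨x + f ⟨p, hp⟩, (Submodule.Quotient.eq R).2 ⟨⟨p, hp⟩, ?_⟩⟩
      simp
  obtain ⟨s, hs⟩ := hM X hX (ModuleCat.of A ((X × P) ⧸ R)) ι g hι hg hex
  let r : ((X × P) ⧸ R) →ₗ[A] X := (LinearEquiv.ofInjective ι hι).symm.toLinearMap ∘ₗ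
    (LinearMap.id - s ∘ₗ g).codRestrict (LinearMap.range ι) (fun y => by
      rw [hex, LinearMap.mem_ker]
      have := LinearMap.congr_fun hs (g y)
      simpa [sub_eq_zero] using this.symm)
  have hr (x : X) : r (ι x) = x := by
    apply (LinearEquiv.ofInjective ι hι).injective
    simp only [r, LinearMap.comp_apply, LinearEquiv.coe_coe, LinearEquiv.apply_symm_apply]
    ext
    have : g (ι x) = 0 := map_zero π
    simp [this]
  refine ⟨r ∘ₗ R.mkQ ∘ₗ LinearMap.inr A X P, ?_⟩
  ext w
  have : R.mkQ (0, (w : P)) = ι (f w) := by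
    refine (Submodule.Quotient.eq R).2 ⟨-w, ?_⟩
    simp
  calc r (R.mkQ (0, (w : P))) = r (ι (f w)) := by rw [this]
    _ = f w := hr _

lemma IsTauRigid.homExactOn_ker {M : ModuleCat.{0} A} (hM : IsTauRigid A M) {P : Type}
    [AddCommGroup P] [Module A P] [Module.Projective A P] (π : P →ₗ[A] M)
    (hπ : Function.Surjective π) {X : ModuleCat.{0} A} (hX : X ∈ Fac A M) :
    HomExactOn A (LinearMap.ker π) X := by
  intro p q hpq f
  have hq : ModuleCat.of A (X ⧸ q) ∈ Fac A M := Fac.of_surjective hX q.mkQ q.mkQ_surjective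
  obtain ⟨h, rfl⟩ := hM.extend π hπ hq f
  obtain ⟨h', rfl⟩ := Module.projective_lifting_property (Submodule.factor hpq) h
    (Submodule.factor_surjective hpq)
  exact ⟨h' ∘ₗ (LinearMap.ker π).subtype, rfl⟩

lemma IsTauRigid.lift_quotient {M V : ModuleCat.{0} A} (hM : IsTauRigid A M)
    (t : Submodule A V) (ht : ModuleCat.of A t ∈ Fac A M) (f : M →ₗ[A] V ⧸ t) :
    ∃ f' : M →ₗ[A] V, t.mkQ ∘ₗ f' = f := by
  let E : Submodule A (V × M) := LinearMap.eqLocus (t.mkQ ∘ₗ LinearMap.fst A V M)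
    (f ∘ₗ LinearMap.snd A V M)
  let ι : t →ₗ[A] E := (LinearMap.inl A V M ∘ₗ t.subtype).codRestrict E (fun x => by
    simp [E, LinearMap.mem_eqLocus])
  let g : E →ₗ[A] M := LinearMap.snd A V M ∘ₗ E.subtype
  have hι : Function.Injective ι := fun x y h => by
    ext
    exact (Prod.ext_iff.1 (congrArg Subtype.val h)).1
  have hg : Function.Surjective g := fun m => by
    obtain ⟨v, hv⟩ := t.mkQ_surjective (f m)
    exact ⟨⟨(v, m), hv⟩, rfl⟩
  have hex : LinearMap.range ι = LinearMap.ker g := by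
    ext y
    constructor
    · rintro ⟨x, rfl⟩
      rfl
    · obtain ⟨⟨v, m⟩, hy⟩ := y
      intro hm
      obtain rfl : m = 0 := hm
      have hv : t.mkQ v = 0 := by
        have : t.mkQ v = f 0 := hy
        rw [this, map_zero]
      exact ⟨⟨v, (Submodule.Quotient.mk_eq_zero t).1 hv⟩, rfl⟩
  obtain ⟨s, hs⟩ := hM _ ht (ModuleCat.of A E) ι g hι hg hex
  refine ⟨LinearMap.fst A V M ∘ₗ E.subtype ∘ₗ s, ?_⟩
  ext m
  have h1 : t.mkQ (s m).1.1 = f (s m).1.2 := (s m).2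
  have h2 : (s m).1.2 = m := LinearMap.congr_fun hs m
  change t.mkQ (s m).1.1 = f m
  rw [h1, h2]

variable {K : Type} [Field K] [Algebra K A]

/-- The trace of a `τ`-rigid module `M` in `V` is in `Fac M`, and there are no nonzero maps
from `M` to the quotient of `V` by it. -/
lemma IsTauRigid.exists_trace {M V : ModuleCat.{0} A} (hM : IsTauRigid A M)
    [Module K V] [IsScalarTower K A V] [Module.Finite K (M →ₗ[A] V)] :
    ∃ t : Submodule A V, ModuleCat.of A t ∈ Fac A M ∧ ∀ f : M →ₗ[A] V ⧸ t, f = 0 := by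
  let b := Module.finBasis K (M →ₗ[A] V)
  let F : (Fin (Module.finrank K (M →ₗ[A] V)) → M) →ₗ[A] V :=
    ∑ i, b i ∘ₗ LinearMap.proj i
  have ht : ModuleCat.of A (LinearMap.range F) ∈ Fac A M :=
    ⟨_, F.rangeRestrict, F.surjective_rangeRestrict⟩
  refine ⟨LinearMap.range F, ht, fun f => ?_⟩
  obtain ⟨f', rfl⟩ := hM.lift_quotient _ ht f
  have hle : LinearMap.range (f' : M →ₗ[A] V) ≤ LinearMap.range F := by
    rintro _ ⟨m, rfl⟩
    refine ⟨fun i => algebraMap K A (b.repr f' i) • m, ?_⟩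
    have := LinearMap.congr_fun (b.sum_repr f') m
    rw [LinearMap.sum_apply] at this
    simpa only [F, LinearMap.sum_apply, LinearMap.comp_apply, LinearMap.proj_apply, map_smul,
      algebraMap_smul, LinearMap.smul_apply] using this
  ext m
  exact (Submodule.Quotient.mk_eq_zero _).2 (hle ⟨m, rfl⟩)

end TauRigid

section Support

variable {A} {K : Type} [Field K] [Algebra K A] {n : ℕ}
  (S : Fin n → ModuleCat.{0} A) [∀ i, Module K (S i)] [∀ i, IsScalarTower K A (S i)]

/-- The linear form sending `v` to `∑ i, v i * (dim Hom(P, S i) - dim Hom(N, S i))`. -/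
noncomputable def homDiffForm (K : Type) [Field K] [Algebra K A] [∀ i, Module K (S i)]
    [∀ i, IsScalarTower K A (S i)] (P N : Type) [AddCommGroup P]
    [Module A P] [AddCommGroup N] [Module A N] : (Fin n → ℝ) →ₗ[ℝ] ℝ :=
  ∑ i, ((Module.finrank K (P →ₗ[A] S i) : ℝ) - Module.finrank K (N →ₗ[A] S i)) •
    LinearMap.proj i

lemma homDiffForm_natCast (P N : Type) [AddCommGroup P] [Module A P] [AddCommGroup N]
    [Module A N] (d : Fin n → ℕ) : homDiffForm S K P N (fun i => (d i : ℝ)) =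
      ((∑ i, d i * Module.finrank K (P →ₗ[A] S i) : ℕ) : ℝ) -
        ((∑ i, d i * Module.finrank K (N →ₗ[A] S i) : ℕ) : ℝ) := by
  push_cast
  rw [← Finset.sum_sub_distrib]
  simp only [homDiffForm, LinearMap.sum_apply, LinearMap.smul_apply, LinearMap.proj_apply,
    smul_eq_mul]
  exact Finset.sum_congr rfl fun i _ => by ring

variable [FiniteDimensional K A]

lemma subsingleton_of_dimVec_eq_zero
    (hdistinct : ∀ i j, Nonempty ((S i : Type) ≃ₗ[A] (S j : Type)) → i = j)
    (hcomplete : ∀ M : ModuleCat.{0} A, IsSimpleModule A M → ∃ i, Nonempty (M ≃ₗ[A] S i))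
    {X : Type} [AddCommGroup X] [Module A X] [Module K X]
    [IsScalarTower K A X] [Module.Finite K X] (h : dimVec A S X = 0) : Subsingleton X := by
  have hle := (finrank_hom_dimVec (K := K) (N := A) (X := X) S hdistinct hcomplete).1
  have : Module.Finite K (A →ₗ[A] X) := finite_hom
  simp only [h, Pi.zero_apply, zero_mul, Finset.sum_const_zero, nonpos_iff_eq_zero] at hle
  have := Module.finrank_zero_iff.1 hle
  refine subsingleton_of_forall_eq 0 fun x => ?_
  have := LinearMap.congr_fun (Subsingleton.elim (LinearMap.toSpanSingleton A X x) 0) 1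
  simpa using this

variable {M : ModuleCat.{0} A} {P : Type} [AddCommGroup P] [Module A P] [Module K P]
  [IsScalarTower K A P] [Module.Finite K P] [Module.Projective A P]

lemma homDiffForm_nonpos
    (hdistinct : ∀ i j, Nonempty ((S i : Type) ≃ₗ[A] (S j : Type)) → i = j)
    (hcomplete : ∀ M : ModuleCat.{0} A, IsSimpleModule A M → ∃ i, Nonempty (M ≃ₗ[A] S i))
    (π : P →ₗ[A] M) (hπ : Function.Surjective π)
    {Y : Type} [AddCommGroup Y] [Module A Y] [Module K Y]
    [IsScalarTower K A Y] [Module.Finite K Y] (h : ∀ f : M →ₗ[A] Y, f = 0) :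
    homDiffForm S K P (LinearMap.ker π) (fun i => (dimVec A S Y i : ℝ)) ≤ 0 := by
  have : Module.Finite K (LinearMap.ker π) :=
    inferInstanceAs (Module.Finite K ((LinearMap.ker π).restrictScalars K))
  have : Module.Finite K (LinearMap.ker π →ₗ[A] Y) := finite_hom
  have hP := (finrank_hom_dimVec (K := K) (N := P) (X := Y) S hdistinct hcomplete).2
    homExactOn_of_projective
  have hN := (finrank_hom_dimVec (K := K) (N := LinearMap.ker π) (X := Y) S
    hdistinct hcomplete).1
  have hle : Module.finrank K (P →ₗ[A] Y) ≤ Module.finrank K (LinearMap.ker π →ₗ[A] Y) := by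
    refine LinearMap.finrank_le_finrank_of_injective
      (f := precompHom (K := K) (LinearMap.ker π).subtype Y) ?_
    rw [← LinearMap.ker_eq_bot, LinearMap.ker_eq_bot']
    intro f hf
    have hker : LinearMap.ker π ≤ LinearMap.ker f := fun x hx => LinearMap.congr_fun hf ⟨x, hx⟩
    have h0 := h ((LinearMap.ker π).liftQ f hker ∘ₗ
      (π.quotKerEquivOfSurjective hπ).symm.toLinearMap)
    ext x
    have := LinearMap.congr_fun h0 (π x)
    have hx : (π.quotKerEquivOfSurjective hπ).symm (π x) = Submodule.Quotient.mk x := by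
      rw [LinearEquiv.symm_apply_eq]
      rfl
    simpa [hx] using this
  rw [homDiffForm_natCast, ← hP, sub_nonpos]
  exact_mod_cast hle.trans hN

lemma homDiffForm_pos
    (hdistinct : ∀ i j, Nonempty ((S i : Type) ≃ₗ[A] (S j : Type)) → i = j)
    (hcomplete : ∀ M : ModuleCat.{0} A, IsSimpleModule A M → ∃ i, Nonempty (M ≃ₗ[A] S i))
    (π : P →ₗ[A] M) (hπ : Function.Surjective π)
    (hM : IsTauRigid A M) {X : ModuleCat.{0} A} [Module K X]
    [IsScalarTower K A X] [Module.Finite K X] [Nontrivial X] (hX : X ∈ Fac A M) :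
    0 < homDiffForm S K P (LinearMap.ker π) (fun i => (dimVec A S X i : ℝ)) := by
  have : Module.Finite K (LinearMap.ker π) :=
    inferInstanceAs (Module.Finite K ((LinearMap.ker π).restrictScalars K))
  have : Module.Finite K (P →ₗ[A] X) := finite_hom
  have hP := (finrank_hom_dimVec (K := K) (N := P) (X := X) S hdistinct hcomplete).2
    homExactOn_of_projective
  have hN := (finrank_hom_dimVec (K := K) (N := LinearMap.ker π) (X := X) S
    hdistinct hcomplete).2 (hM.homExactOn_ker π hπ hX)
  let ρ := precompHom (K := K) (LinearMap.ker π).subtype X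
  have hρ : LinearMap.range ρ = ⊤ := LinearMap.range_eq_top.2 fun f => hM.extend π hπ hX f
  have hrank := LinearMap.finrank_range_add_finrank_ker ρ
  rw [hρ, finrank_top] at hrank
  obtain ⟨f, hf⟩ := exists_hom_ne_zero_of_mem_Fac hX
  have hfπ : f ∘ₗ π ∈ LinearMap.ker ρ := by
    ext x
    have : π x = 0 := x.2
    simp [ρ, precompHom, this]
  have : Nontrivial (LinearMap.ker ρ) := by
    refine ⟨⟨f ∘ₗ π, hfπ⟩, 0, fun h => hf ?_⟩
    ext m
    obtain ⟨x, rfl⟩ := hπ m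
    exact LinearMap.congr_fun (congrArg Subtype.val h) x
  have hpos : 0 < Module.finrank K (LinearMap.ker ρ) := Module.finrank_pos
  rw [homDiffForm_natCast, ← hP, ← hN, sub_pos]
  exact_mod_cast (by omega)

end Support

lemma dimVec_eq_zero_of_subsingleton {A : Type} [Ring A] {n : ℕ} (S : Fin n → ModuleCat.{0} A)
    (hsimple : ∀ i, IsSimpleModule A (S i)) (X : Type) [AddCommGroup X] [Module A X]
    [Subsingleton X] : dimVec A S X = 0 := by
  ext i
  have := hsimple i
  have := IsSimpleModule.nontrivial A (S i)
  rw [dimVec]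
  split_ifs with h
  · rw [Pi.zero_apply, Nat.card_eq_zero]
    left
    constructor
    rintro ⟨j, ⟨e⟩⟩
    exact not_subsingleton (S i) (e.symm.injective.subsingleton)
  · rfl

lemma convex_eq_zero_or_pos {E : Type} [AddCommGroup E] [Module ℝ E] (θ : E →ₗ[ℝ] ℝ) :
    Convex ℝ {v | v = 0 ∨ 0 < θ v} := by
  rintro v hv w hw a b ha hb -
  rcases ha.eq_or_lt with rfl | ha
  · rcases hb.eq_or_lt with rfl | hb
    · left; simp
    · rcases hw with rfl | hw
      · left; simp
      · right; simpa using mul_pos hb hw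
  · rcases hv with rfl | hv
    · rcases hb.eq_or_lt with rfl | hb
      · left; simp
      · rcases hw with rfl | hw
        · left; simp
        · right; simpa using mul_pos hb hw
    · right
      rcases hw with rfl | hw
      · simpa using mul_pos ha hv
      · have := mul_pos ha hv
        have := mul_nonneg hb hw.le
        simp only [map_add, map_smul, smul_eq_mul]
        linarith

lemma mem_Fac_of_newtonPolytope_subset {A : Type} [Ring A]
    {K : Type} [Field K] [Algebra K A] [FiniteDimensional K A]
    {n : ℕ} (S : Fin n → ModuleCat.{0} A)
    (hsimple : ∀ i, IsSimpleModule A (S i))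
    (hdistinct : ∀ i j, Nonempty ((S i : Type) ≃ₗ[A] (S j : Type)) → i = j)
    (hcomplete : ∀ M : ModuleCat.{0} A, IsSimpleModule A M → ∃ i, Nonempty (M ≃ₗ[A] S i))
    {U V M : ModuleCat.{0} A} [Module.Finite A U] [Module.Finite A V] [Module.Finite A M]
    (hNewton : newtonPolytope A S V ⊆ newtonPolytope A S U) (hM : IsTauRigid A M)
    (hU : U ∈ Fac A M) : V ∈ Fac A M := by
  let _ (X : ModuleCat.{0} A) : Module K X := Module.compHom X (algebraMap K A)
  have _ (X : ModuleCat.{0} A) : IsScalarTower K A X :=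
    ⟨fun c a x => by rw [Algebra.smul_def, mul_smul]; rfl⟩
  have hfin (X : ModuleCat.{0} A) [Module.Finite A X] : Module.Finite K X :=
    Module.Finite.trans A X
  have := hfin U
  have := hfin V
  have := hfin M
  have : Module.Finite K (M →ₗ[A] V) := finite_hom
  obtain ⟨m, π, hπ⟩ := Module.Finite.exists_fin' A M
  obtain ⟨t, ht, htM⟩ := hM.exists_trace (K := K) (V := V)
  have : Module.Finite K (V ⧸ t) :=
    Module.Finite.of_surjective (t.mkQ.restrictScalars K) t.mkQ_surjective
  have hnonpos := homDiffForm_nonpos S hdistinct hcomplete π hπ htM (K := K)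
  have hC : newtonPolytope A S U ⊆
      {v | v = 0 ∨ 0 < homDiffForm S K (Fin m → A) (LinearMap.ker π) v} := by
    refine convexHull_min ?_ (convex_eq_zero_or_pos _)
    rintro _ ⟨p, rfl⟩
    rcases subsingleton_or_nontrivial (U ⧸ p) with h | h
    · left
      ext i
      simp [dimVec_eq_zero_of_subsingleton S hsimple (U ⧸ p)]
    · right
      have hp : ModuleCat.of A (U ⧸ p) ∈ Fac A M :=
        Fac.of_surjective hU p.mkQ p.mkQ_surjective
      have := hfin (ModuleCat.of A (U ⧸ p))
      have : Nontrivial (ModuleCat.of A (U ⧸ p)) := h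
      exact homDiffForm_pos S hdistinct hcomplete π hπ hM hp
  have hzero : dimVec A S (V ⧸ t) = 0 := by
    rcases hC (hNewton (subset_convexHull ℝ _ ⟨t, rfl⟩)) with h | h
    · ext i
      exact Nat.cast_eq_zero.1 (congrFun h i)
    · exact absurd h hnonpos.not_gt
  have := subsingleton_of_dimVec_eq_zero (K := K) S hdistinct hcomplete hzero
  have htop : t = ⊤ := Submodule.Quotient.subsingleton_iff.1 this
  subst htop
  exact Fac.of_surjective ht (⊤ : Submodule A V).subtype fun x => ⟨⟨x, trivial⟩, rfl⟩

/-- if `U` and `V` have the same Newton polytope, then for every τ-rigid module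
`M` in `mod A` (in particular, for the module `M` of any τ-tilting pair `(M, P)`),
`U ∈ Fac M` iff `V ∈ Fac M`. -/
theorem mem_Fac_iff_of_newtonPolytope_eq (A : Type) [Ring A]
    (K : Type) [Field K] [Algebra K A] [FiniteDimensional K A]
    (n : ℕ) (S : Fin n → ModuleCat.{0} A)
    (hsimple : ∀ i, IsSimpleModule A (S i))
    (hdistinct : ∀ i j, Nonempty ((S i : Type) ≃ₗ[A] (S j : Type)) → i = j)
    (hcomplete : ∀ M : ModuleCat.{0} A, IsSimpleModule A M → ∃ i, Nonempty (M ≃ₗ[A] S i))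
    (U V : ModuleCat.{0} A) (hU : Module.Finite A U) (hV : Module.Finite A V)
    (hNewton : newtonPolytope A S U = newtonPolytope A S V) :
    ∀ M : ModuleCat.{0} A, Module.Finite A M → IsTauRigid A M →
      (U ∈ Fac A M ↔ V ∈ Fac A M) :=
  fun _ _ hM =>
    ⟨mem_Fac_of_newtonPolytope_subset (K := K) S hsimple hdistinct hcomplete hNewton.ge hM,
      mem_Fac_of_newtonPolytope_subset (K := K) S hsimple hdistinct hcomplete hNewton.le hM⟩
end

section
/- Let U and V be left finite bricks in mod A with the same Newton polytope, N(U) = N(V). Then U and V are isomorphic. -/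
/-! Common definitions: finite-dimensional modules over a finite-dimensional algebra,
quotient modules, dimension vectors via composition series, Newton polytopes,
torsion classes, `Fac`, τ-rigidity, bricks, etc. -/

variable (A : Type) [Ring A]

section Helpers

variable {A}

section HomDim

variable (K : Type) [Field K] [Algebra K A]

variable (A) in
/-- The `K`-dimension of `Hom_A(P, X)`, where `K` acts on `X` through `A`. -/
noncomputable def homDim (P X : Type) [AddCommGroup P] [Module A P]
    [AddCommGroup X] [Module A X] : ℕ :=
  letI : Module K X := Module.compHom X (algebraMap K A)
  haveI : IsScalarTower K A X := IsScalarTower.of_algebraMap_smul fun _ _ => rfl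
  Module.finrank K (P →ₗ[A] X)

theorem isScalarTower_compHom (X : Type) [AddCommGroup X] [Module A X] :
    letI : Module K X := Module.compHom X (algebraMap K A)
    IsScalarTower K A X :=
  let _ : Module K X := Module.compHom X (algebraMap K A)
  IsScalarTower.of_algebraMap_smul fun _ _ => rfl

variable (A) in
theorem finite_linearMap_of_isScalarTower [FiniteDimensional K A] (P X : Type) [AddCommGroup P]
    [Module A P] [AddCommGroup X] [Module A X] [Module K X] [IsScalarTower K A X]
    [Module.Finite A P] [Module.Finite A X] : Module.Finite K (P →ₗ[A] X) := by
  let _ : Module K P := Module.compHom P (algebraMap K A)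
  have : IsScalarTower K A P := isScalarTower_compHom K P
  have : Module.Finite K P := Module.Finite.trans A P
  have : Module.Finite K X := Module.Finite.trans A X
  exact Module.Finite.of_injective (LinearMap.restrictScalarsₗ K A P X K)
    (LinearMap.restrictScalars_injective K)

variable {P Q X Y Z : Type} [AddCommGroup P] [Module A P] [AddCommGroup Q] [Module A Q]
  [AddCommGroup X] [Module A X] [AddCommGroup Y] [Module A Y] [AddCommGroup Z] [Module A Z]

theorem homDim_congr (e : X ≃ₗ[A] Y) : homDim A K P X = homDim A K P Y := by
  let _ : Module K X := Module.compHom X (algebraMap K A)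
  have : IsScalarTower K A X := isScalarTower_compHom K X
  let _ : Module K Y := Module.compHom Y (algebraMap K A)
  have : IsScalarTower K A Y := isScalarTower_compHom K Y
  exact LinearEquiv.finrank_eq (LinearEquiv.ofLinearMap
    (LinearMap.compRight K (e : X →ₗ[A] Y)) (LinearMap.compRight K (e.symm : Y →ₗ[A] X))
    (by ext; simp) (by ext; simp))

theorem homDim_of_subsingleton [Subsingleton X] : homDim A K P X = 0 := by
  let _ : Module K X := Module.compHom X (algebraMap K A)
  have : IsScalarTower K A X := isScalarTower_compHom K X
  exact Module.finrank_zero_of_subsingleton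

theorem homDim_add_of_exact [FiniteDimensional K A] [Module.Finite A P] [Module.Projective A P]
    [Module.Finite A Y] (f : X →ₗ[A] Y) (g : Y →ₗ[A] Z) (hf : Function.Injective f)
    (hg : Function.Surjective g) (hfg : LinearMap.range f = LinearMap.ker g) :
    homDim A K P Y = homDim A K P X + homDim A K P Z := by
  let _ : Module K X := Module.compHom X (algebraMap K A)
  have : IsScalarTower K A X := isScalarTower_compHom K X
  let _ : Module K Y := Module.compHom Y (algebraMap K A)
  have : IsScalarTower K A Y := isScalarTower_compHom K Y
  let _ : Module K Z := Module.compHom Z (algebraMap K A)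
  have : IsScalarTower K A Z := isScalarTower_compHom K Z
  have := finite_linearMap_of_isScalarTower A K P Y
  let F : (P →ₗ[A] X) →ₗ[K] (P →ₗ[A] Y) := LinearMap.compRight K f
  let G : (P →ₗ[A] Y) →ₗ[K] (P →ₗ[A] Z) := LinearMap.compRight K g
  have hF : Function.Injective F := fun a b hab =>
    LinearMap.ext fun x => hf (LinearMap.congr_fun hab x)
  have hG : Function.Surjective G := fun h => Module.projective_lifting_property g h hg
  have hFG : LinearMap.range F = LinearMap.ker G := by
    ext h
    constructor
    · rintro ⟨k, rfl⟩
      exact LinearMap.ext fun x => LinearMap.mem_ker.1 (hfg.le (LinearMap.mem_range_self f (k x)))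
    · intro hh
      have hh' : ∀ x, h x ∈ LinearMap.range f := fun x => by
        rw [hfg]; exact LinearMap.congr_fun (LinearMap.mem_ker.1 hh) x
      let e := LinearEquiv.ofInjective f hf
      refine ⟨e.symm.toLinearMap ∘ₗ h.codRestrict _ hh', LinearMap.ext fun x => ?_⟩
      exact congrArg Subtype.val (e.apply_symm_apply ⟨h x, hh' x⟩)
  have h1 := LinearMap.finrank_range_add_finrank_ker G
  rw [← hFG, LinearMap.finrank_range_of_inj hF, LinearMap.range_eq_top.2 hG, finrank_top] at h1
  change Module.finrank K (P →ₗ[A] Y) = Module.finrank K (P →ₗ[A] X) +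
    Module.finrank K (P →ₗ[A] Z)
  omega

theorem homDim_le_of_forall_comp_eq_zero [FiniteDimensional K A] [Module.Finite A P]
    [Module.Finite A X] (d : P →ₗ[A] Q) (h : ∀ f : Q →ₗ[A] X, f.comp d = 0 → f = 0) :
    homDim A K Q X ≤ homDim A K P X := by
  let _ : Module K X := Module.compHom X (algebraMap K A)
  have : IsScalarTower K A X := isScalarTower_compHom K X
  have := finite_linearMap_of_isScalarTower A K P X
  exact LinearMap.finrank_le_finrank_of_injective (f := LinearMap.lcomp K X d)
    ((injective_iff_map_eq_zero _).2 fun f hf => h f hf)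

theorem homDim_lt_of_forall_exists_comp_eq [FiniteDimensional K A] [Module.Finite A Q]
    [Module.Finite A X] (d : P →ₗ[A] Q) (h : ∀ g : P →ₗ[A] X, ∃ f : Q →ₗ[A] X, f.comp d = g)
    (h' : ∃ f : Q →ₗ[A] X, f ≠ 0 ∧ f.comp d = 0) :
    homDim A K P X < homDim A K Q X := by
  let _ : Module K X := Module.compHom X (algebraMap K A)
  have : IsScalarTower K A X := isScalarTower_compHom K X
  have := finite_linearMap_of_isScalarTower A K Q X
  let D : (Q →ₗ[A] X) →ₗ[K] (P →ₗ[A] X) := LinearMap.lcomp K X d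
  have hD : LinearMap.range D = ⊤ := LinearMap.range_eq_top.2 h
  have hker : 0 < Module.finrank K (LinearMap.ker D) := by
    rw [Module.finrank_pos_iff]
    obtain ⟨f, hf, hfd⟩ := h'
    exact ⟨⟨f, hfd⟩, 0, fun e => hf (congrArg Subtype.val e)⟩
  have h1 := LinearMap.finrank_range_add_finrank_ker D
  rw [hD, finrank_top] at h1
  change Module.finrank K (P →ₗ[A] X) < Module.finrank K (Q →ₗ[A] X)
  omega

theorem Fin.last_eq_zero_add_sum {m : ℕ} (f : Fin (m + 1) → ℕ) (g : Fin m → ℕ)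
    (h : ∀ j, f j.succ = f j.castSucc + g j) : f (Fin.last m) = f 0 + ∑ j, g j := by
  induction m with
  | zero => simp
  | succ m ih =>
    rw [Fin.sum_univ_castSucc, ← Fin.succ_last, h, ← add_assoc]
    congr 1
    exact ih (fun j => f j.castSucc) (fun j => g j.castSucc) fun j => h j.castSucc

/-- The successive quotient of a composition series at the index `j`. -/
abbrev compositionFactor (s : CompositionSeries (Submodule A X)) (j : Fin s.length) : Type :=
  ↥(s j.succ) ⧸ Submodule.comap (s j.succ).subtype (s j.castSucc)

theorem homDim_compositionSeries [FiniteDimensional K A] [Module.Finite A P]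
    [Module.Projective A P] [Module.Finite A X] (s : CompositionSeries (Submodule A X))
    (h0 : s.head = ⊥) (h1 : s.last = ⊤) :
    homDim A K P X = ∑ j, homDim A K P (compositionFactor s j) := by
  have : IsNoetherianRing A := isNoetherian_of_tower K inferInstance
  have key := Fin.last_eq_zero_add_sum (fun j => homDim A K P (s j))
    (fun j => homDim A K P (compositionFactor s j)) fun j => by
      have hle : s j.castSucc ≤ s j.succ := (s.lt_succ j).le
      refine homDim_add_of_exact K (Submodule.inclusion hle) (Submodule.mkQ _)
        (Submodule.inclusion_injective hle) (Submodule.mkQ_surjective _) ?_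
      rw [Submodule.ker_mkQ, Submodule.range_inclusion]
  have hh : (s 0 : Submodule A X) = ⊥ := h0
  have hl : (s (Fin.last _) : Submodule A X) = ⊤ := h1
  have : Subsingleton (s 0) := by rw [hh]; infer_instance
  rw [homDim_of_subsingleton K (X := s 0), zero_add] at key
  rw [← key, hl]
  exact (homDim_congr K Submodule.topEquiv).symm

open Classical in
theorem homDim_eq_sum_dimVec [FiniteDimensional K A] [Module.Finite A P] [Module.Projective A P]
    [Module.Finite A X] {n : ℕ} {S : Fin n → ModuleCat.{0} A}
    (hdistinct : ∀ i j, Nonempty ((S i : Type) ≃ₗ[A] (S j : Type)) → i = j)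
    (hcomplete : ∀ M : ModuleCat.{0} A, IsSimpleModule A M → ∃ i, Nonempty (M ≃ₗ[A] S i)) :
    homDim A K P X = ∑ i, dimVec A S X i * homDim A K P (S i) := by
  have : IsNoetherianRing A := isNoetherian_of_tower K inferInstance
  have : IsArtinianRing A := isArtinian_of_tower K inferInstance
  have h : ∃ s : CompositionSeries (Submodule A X),
      RelSeries.head s = ⊥ ∧ RelSeries.last s = ⊤ :=
    exists_compositionSeries_of_isNoetherian_isArtinian A X
  set s := h.choose with hs
  have hfac : ∀ j : Fin s.length, ∃ i, Nonempty (compositionFactor s j ≃ₗ[A] S i) := fun j =>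
    hcomplete (ModuleCat.of A (compositionFactor s j))
      ((covBy_iff_quot_is_simple (s.lt_succ j).le).1 (s.step j))
  choose c hc using hfac
  have hiff : ∀ j i, Nonempty (compositionFactor s j ≃ₗ[A] S i) ↔ c j = i := fun j i =>
    ⟨fun ⟨e⟩ => hdistinct _ _ ⟨(hc j).some.symm.trans e⟩, fun e => e ▸ hc j⟩
  have hdim : ∀ i, dimVec A S X i = (Finset.univ.filter fun j => c j = i).card := fun i => by
    rw [dimVec, dif_pos h, ← Fintype.card_subtype, ← Nat.card_eq_fintype_card]
    exact Nat.card_congr (Equiv.subtypeEquivRight fun j => hiff j i)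
  rw [homDim_compositionSeries K s h.choose_spec.1 h.choose_spec.2]
  simp_rw [hdim]
  rw [← Finset.sum_fiberwise_of_maps_to (g := c) (t := Finset.univ) fun _ _ => Finset.mem_univ _]
  refine Finset.sum_congr rfl fun i _ => ?_
  rw [← smul_eq_mul]
  refine Finset.sum_eq_card_nsmul fun j hj => ?_
  exact homDim_congr K ((hiff j i).2 (Finset.mem_filter.1 hj).2).some

end HomDim
theorem LinearMap.exists_comp_eq_of_ker_le {X Y Z : Type} [AddCommGroup X] [Module A X]
    [AddCommGroup Y] [Module A Y] [AddCommGroup Z] [Module A Z] {f : X →ₗ[A] Y}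
    (hf : Function.Surjective f) {g : X →ₗ[A] Z} (h : LinearMap.ker f ≤ LinearMap.ker g) :
    ∃ k : Y →ₗ[A] Z, k.comp f = g := by
  refine ⟨((LinearMap.ker f).liftQ g h).comp (f.quotKerEquivOfSurjective hf).symm.toLinearMap,
    LinearMap.ext fun x => ?_⟩
  have : (f.quotKerEquivOfSurjective hf).symm (f x) = (LinearMap.ker f).mkQ x := by
    rw [LinearEquiv.symm_apply_eq]; rfl
  change (LinearMap.ker f).liftQ g h ((f.quotKerEquivOfSurjective hf).symm (f x)) = g x
  rw [this]; rfl

/-- Over an Artinian ring every finite module has a projective cover. -/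
theorem exists_projective_cover [IsArtinianRing A] [IsNoetherianRing A] (C : Type)
    [AddCommGroup C] [Module A C] [Module.Finite A C] :
    ∃ (P : ModuleCat.{0} A) (p : P →ₗ[A] C), Module.Finite A P ∧ Module.Projective A P ∧
      Function.Surjective p ∧ ∀ N : Submodule A P, N.map p = ⊤ → N = ⊤ := by
  obtain ⟨m, q, hq⟩ := Module.Finite.exists_fin' A C
  let Good : Set (Submodule A (Fin m → A)) := {Q | Module.Projective A Q ∧ Q.map q = ⊤}
  have hne : Good.Nonempty := ⟨⊤, Module.Projective.of_equiv Submodule.topEquiv.symm, by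
    rw [Submodule.map_top, LinearMap.range_eq_top.2 hq]⟩
  obtain ⟨Q, ⟨hQ, hQq⟩, hmin⟩ := WellFounded.has_min
    (wellFounded_lt (α := Submodule A (Fin m → A))) Good hne
  let p : Q →ₗ[A] C := q.comp Q.subtype
  have hp : Function.Surjective p := by
    rw [← LinearMap.range_eq_top, LinearMap.range_comp, Submodule.range_subtype, hQq]
  refine ⟨ModuleCat.of A Q, p, inferInstanceAs (Module.Finite A Q), hQ, hp, fun N hN => ?_⟩
  have hpN : Function.Surjective (p.comp N.subtype) := by
    rw [← LinearMap.range_eq_top, LinearMap.range_comp, Submodule.range_subtype, hN]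
  obtain ⟨r, hr⟩ := Module.projective_lifting_property (p.comp N.subtype) p hpN
  let e : Module.End A Q := N.subtype.comp r
  have hpe : ∀ x, p (e x) = p x := fun x => LinearMap.congr_fun hr x
  have hpek : ∀ k x, p ((e ^ k) x) = p x := fun k => by
    induction k with
    | zero => intro x; rfl
    | succ k ih => intro x; rw [pow_succ', Module.End.mul_apply, hpe, ih]
  obtain ⟨k, hk⟩ := ((LinearMap.eventually_isCompl_ker_pow_range_pow e).and
    (Filter.eventually_ge_atTop 1)).exists
  have hproj : Module.Projective A (LinearMap.range (e ^ k)) :=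
    Module.Projective.of_split (LinearMap.range (e ^ k)).subtype
      (Submodule.projectionOnto _ _ hk.1.symm) (by ext x; simp)
  have hgood : (LinearMap.range (e ^ k)).map Q.subtype ∈ Good := by
    refine ⟨Module.Projective.of_equiv
      (Submodule.equivMapOfInjective Q.subtype Q.injective_subtype _), ?_⟩
    rw [eq_top_iff]
    rintro c -
    obtain ⟨x, rfl⟩ := hp c
    exact ⟨_, ⟨_, ⟨x, rfl⟩, rfl⟩, hpek k x⟩
  have htop : LinearMap.range (e ^ k) = ⊤ := by
    have hle : (LinearMap.range (e ^ k)).map Q.subtype ≤ Q := Submodule.map_subtype_le _ _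
    have heq := (lt_or_eq_of_le hle).resolve_left (hmin _ hgood)
    rw [eq_top_iff]
    rintro x -
    obtain ⟨y, hy, hyx⟩ := heq.ge x.2
    rwa [← Subtype.ext hyx]
  rw [eq_top_iff, ← htop]
  obtain ⟨j, rfl⟩ := Nat.exists_eq_succ_of_ne_zero (Nat.one_le_iff_ne_zero.1 hk.2)
  rintro _ ⟨x, rfl⟩
  rw [pow_succ', Module.End.mul_apply]
  exact (r _).2

section Torsion

theorem isTorsionClass_torsGen_of_mem {T : Set (ModuleCat.{0} A)} {N : ModuleCat.{0} A}
    (hT : IsTorsionClass A T) (hN : N ∈ T) : IsTorsionClass A (torsGen A N) := by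
  refine ⟨fun M hM => hT.1 M (hM T ⟨hT, hN⟩), fun M hM X e T' hT' => ?_,
    fun M hM X e T' hT' => ?_, fun L E X f g hf hg hfg hL hX T' hT' => ?_⟩
  · exact hT'.1.2.1 M (hM T' hT') X e
  · exact hT'.1.2.2.1 M (hM T' hT') X e
  · exact hT'.1.2.2.2 L E X f g hf hg hfg (hL T' hT') (hX T' hT')

theorem mem_torsGen_self (N : ModuleCat.{0} A) : N ∈ torsGen A N := fun _ h => h.2

variable {T : Set (ModuleCat.{0} A)}

/-- The finite modules all of whose nonzero quotients receive a nonzero map from `U`. -/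
def hitByHom (U : ModuleCat.{0} A) : Set (ModuleCat.{0} A) :=
  {X | Module.Finite A X ∧ ∀ (Y : ModuleCat.{0} A) (f : X →ₗ[A] Y), Function.Surjective f →
    Nontrivial Y → ∃ g : U →ₗ[A] Y, g ≠ 0}

theorem isTorsionClass_hitByHom (U : ModuleCat.{0} A) : IsTorsionClass A (hitByHom U) := by
  have hquot : ∀ M ∈ hitByHom U, ∀ X : ModuleCat.{0} A, IsQuotientOf A M X →
      X ∈ hitByHom U := by
    rintro M ⟨hM, hM'⟩ X ⟨f, hf⟩
    exact ⟨Module.Finite.of_surjective f hf, fun Y g hg hY => hM' Y (g.comp f) (hg.comp hf) hY⟩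
  refine ⟨fun M hM => hM.1, fun M hM N ⟨e⟩ => hquot M hM N ⟨e, e.surjective⟩, hquot, ?_⟩
  rintro L E N f g hf hg hfg ⟨hL, hL'⟩ ⟨hN, hN'⟩
  refine ⟨?_, fun Y h hh hY => ?_⟩
  · have hr : (LinearMap.range f).FG := Module.Finite.iff_fg.1 (Module.Finite.range f)
    refine ⟨Submodule.fg_of_fg_map_of_fg_inf_ker g ?_ ?_⟩
    · rw [Submodule.map_top, LinearMap.range_eq_top.2 hg]; exact hN.1
    · rwa [top_inf_eq, ← hfg]
  · by_cases h0 : h.comp f = 0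
    · have hker : LinearMap.ker g ≤ LinearMap.ker h := by
        rw [← hfg]
        rintro _ ⟨x, rfl⟩
        exact LinearMap.congr_fun h0 x
      obtain ⟨h', hh'⟩ := LinearMap.exists_comp_eq_of_ker_le hg hker
      refine hN' Y h' (fun y => ?_) hY
      obtain ⟨x, rfl⟩ := hh y
      exact ⟨g x, LinearMap.congr_fun hh' x⟩
    · let R := LinearMap.range (h.comp f)
      have hR : Nontrivial R := by
        rw [Submodule.nontrivial_iff_ne_bot]
        exact fun hb => h0 (LinearMap.range_eq_bot.1 hb)
      obtain ⟨k, hk⟩ := hL' (ModuleCat.of A R) (h.comp f).rangeRestrict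
        (LinearMap.surjective_rangeRestrict _) hR
      refine ⟨R.subtype.comp k, fun hc => hk (LinearMap.ext fun x => ?_)⟩
      exact Subtype.ext (LinearMap.congr_fun hc x)

theorem mem_hitByHom_self (U : ModuleCat.{0} A) (hU : Module.Finite A U) : U ∈ hitByHom U := by
  refine ⟨hU, fun Y f hf hY => ⟨f, ?_⟩⟩
  rintro rfl
  obtain ⟨y, hy⟩ := exists_ne (0 : Y)
  obtain ⟨x, hx⟩ := hf y
  exact hy hx.symm

theorem torsGen_subset_hitByHom {U : ModuleCat.{0} A} (hU : Module.Finite A U) :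
    torsGen A U ⊆ hitByHom U :=
  Set.sInter_subset_of_mem ⟨isTorsionClass_hitByHom U, mem_hitByHom_self U hU⟩

theorem IsBrick.surjective_of_mem_torsGen {U X : ModuleCat.{0} A} (hU : Module.Finite A U)
    (hUb : IsBrick A U) (hX : X ∈ torsGen A U) (f : X →ₗ[A] U) (hf : f ≠ 0) :
    Function.Surjective f := by
  have hR : Nontrivial (LinearMap.range f) := by
    rw [Submodule.nontrivial_iff_ne_bot]
    exact fun hb => hf (LinearMap.range_eq_bot.1 hb)
  obtain ⟨g, hg⟩ := (torsGen_subset_hitByHom hU hX).2 (ModuleCat.of A (LinearMap.range f))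
    f.rangeRestrict (LinearMap.surjective_rangeRestrict _) hR
  have hne : (LinearMap.range f).subtype.comp g ≠ 0 := fun hc =>
    hg (LinearMap.ext fun x => Subtype.ext (LinearMap.congr_fun hc x))
  intro u
  obtain ⟨x, hx⟩ := (hUb.2 _ hne).2 u
  exact hx ▸ (g x).2

/-- Bricks generating each other's torsion classes are isomorphic. -/
theorem IsBrick.nonempty_equiv_of_mem_torsGen {U V : ModuleCat.{0} A} (hU : Module.Finite A U)
    (hV : Module.Finite A V) (hUb : IsBrick A U) (hVb : IsBrick A V) (hVU : V ∈ torsGen A U)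
    (hUV : U ∈ torsGen A V) : Nonempty (U ≃ₗ[A] V) := by
  obtain ⟨f, hf⟩ := (torsGen_subset_hitByHom hU hVU).2 V LinearMap.id Function.surjective_id hVb.1
  obtain ⟨g, hg⟩ := (torsGen_subset_hitByHom hV hUV).2 U LinearMap.id Function.surjective_id hUb.1
  have hfs := hVb.surjective_of_mem_torsGen hV hUV f hf
  have hgs := hUb.surjective_of_mem_torsGen hU hVU g hg
  have hne : g.comp f ≠ 0 := fun hc => by
    obtain ⟨u, hu⟩ := (@exists_ne _ hUb.1 (0 : U))
    obtain ⟨x, hx⟩ := (hgs.comp hfs) u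
    exact hu (hx ▸ LinearMap.congr_fun hc x)
  have hinj : Function.Injective (g.comp f) := (hUb.2 _ hne).1
  exact ⟨LinearEquiv.ofBijective f ⟨Function.Injective.of_comp hinj, hfs⟩⟩

theorem IsTorsionClass.mem_of_surjective (hT : IsTorsionClass A T) {M X : ModuleCat.{0} A}
    (hM : M ∈ T) (f : M →ₗ[A] X) (hf : Function.Surjective f) : X ∈ T :=
  hT.2.2.1 M hM X ⟨f, hf⟩

/-- `a : N` is a minimal left `T`-approximation of the regular module, written as an element. -/
structure IsMinimalApprox (T : Set (ModuleCat.{0} A)) (N : ModuleCat.{0} A) (a : N) : Prop where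
  mem : N ∈ T
  exists_apply_eq : ∀ X ∈ T, ∀ x : X, ∃ f : N →ₗ[A] X, f a = x
  surjective : ∀ e : N →ₗ[A] N, e a = a → Function.Surjective e

theorem exists_isMinimalApprox (K : Type) [Field K] [Algebra K A] [FiniteDimensional K A]
    (hT : IsTorsionClass A T) {M : ModuleCat.{0} A} (hM : Module.Finite A M)
    (hTM : T = Fac A M) : ∃ (N : ModuleCat.{0} A) (a : N), IsMinimalApprox T N a := by
  have : IsArtinianRing A := isArtinian_of_tower K inferInstance
  let _ : Module K M := Module.compHom M (algebraMap K A)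
  have : IsScalarTower K A M := isScalarTower_compHom K M
  have : Module.Finite K M := Module.Finite.trans A M
  obtain ⟨k, m, hm⟩ := Module.Finite.exists_fin (R := K) (M := M)
  have happ : ∀ X ∈ T, ∀ x : X, ∃ f : (Fin k → M) →ₗ[A] X, f m = x := by
    intro X hX x
    rw [hTM] at hX
    obtain ⟨r, q, hq⟩ := hX
    obtain ⟨y, rfl⟩ := hq x
    have hy : ∀ j, ∃ c : Fin k → K, ∑ i, c i • m i = y j := fun j =>
      (Submodule.mem_span_range_iff_exists_fun K).1 (hm ▸ Submodule.mem_top)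
    choose c hc using hy
    refine ⟨q.comp (LinearMap.pi fun j => ∑ i, c j i • LinearMap.proj i), ?_⟩
    refine congrArg q (funext fun j => ?_)
    rw [LinearMap.pi_apply, ← hc j, LinearMap.sum_apply]
    rfl
  have hMk : ModuleCat.of A (Fin k → M) ∈ T := by
    rw [hTM]
    exact ⟨k, LinearMap.id, Function.surjective_id⟩
  let Good : Set (Submodule A (Fin k → M)) := {Q | ModuleCat.of A Q ∈ T ∧ m ∈ Q}
  have hne : Good.Nonempty := ⟨⊤, hT.mem_of_surjective hMk
    (X := ModuleCat.of A (⊤ : Submodule A (Fin k → M)))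
    Submodule.topEquiv.symm.toLinearMap Submodule.topEquiv.symm.surjective, Submodule.mem_top⟩
  obtain ⟨Q, ⟨hQ, hmQ⟩, hmin⟩ := WellFounded.has_min
    (wellFounded_lt (α := Submodule A (Fin k → M))) Good hne
  refine ⟨ModuleCat.of A Q, ⟨m, hmQ⟩, hQ, fun X hX x => ?_, fun e he => ?_⟩
  · obtain ⟨f, hf⟩ := happ X hX x
    exact ⟨f.comp Q.subtype, hf⟩
  · let e' : Q →ₗ[A] (Fin k → M) := Q.subtype.comp e
    have hgood : LinearMap.range e' ∈ Good :=
      ⟨hT.mem_of_surjective hQ (X := ModuleCat.of A (LinearMap.range e')) e'.rangeRestrict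
        (LinearMap.surjective_rangeRestrict _), ⟨m, hmQ⟩, congrArg Subtype.val he⟩
    have hle : LinearMap.range e' ≤ Q := by
      rintro _ ⟨x, rfl⟩
      exact (e x).2
    have heq := (lt_or_eq_of_le hle).resolve_left (hmin _ hgood)
    intro x
    obtain ⟨y, hy⟩ := heq.ge x.2
    exact ⟨y, Subtype.ext hy⟩

variable {N : ModuleCat.{0} A} {a : N}

theorem IsMinimalApprox.exists_section [IsNoetherianRing A] (hT : IsTorsionClass A T)
    (ha : IsMinimalApprox T N a) {X E : ModuleCat.{0} A} (hX : X ∈ T) (j : X →ₗ[A] E)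
    (q : E →ₗ[A] N) (hj : Function.Injective j) (hq : Function.Surjective q)
    (hjq : LinearMap.range j = LinearMap.ker q) : ∃ s : N →ₗ[A] E, q.comp s = LinearMap.id := by
  have hN : Module.Finite A N := hT.1 N ha.mem
  have hE : E ∈ T := hT.2.2.2 X E N j q hj hq hjq hX ha.mem
  obtain ⟨y, hy⟩ := hq a
  obtain ⟨f, hf⟩ := ha.exists_apply_eq E hE y
  have hsurj := ha.surjective (q.comp f) (by rw [LinearMap.comp_apply, hf, hy])
  let e := LinearEquiv.ofBijective (q.comp f)
    ⟨IsNoetherian.injective_of_surjective_endomorphism _ hsurj, hsurj⟩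
  exact ⟨f.comp e.symm.toLinearMap, LinearMap.ext fun x => e.apply_symm_apply x⟩

theorem IsMinimalApprox.exists_extend [IsNoetherianRing A] (hT : IsTorsionClass A T)
    (ha : IsMinimalApprox T N a) {P : Type} [AddCommGroup P] [Module A P] (π : P →ₗ[A] N)
    (hπ : Function.Surjective π) {X : ModuleCat.{0} A} (hX : X ∈ T)
    (φ : LinearMap.ker π →ₗ[A] X) : ∃ h : P →ₗ[A] X, h.comp (LinearMap.ker π).subtype = φ := by
  let γ : LinearMap.ker π →ₗ[A] X × P := φ.prod (-(LinearMap.ker π).subtype)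
  let G := LinearMap.range γ
  have hG : ∀ z, z ∈ G ↔ ∃ k, γ k = z := fun z => LinearMap.mem_range
  let j : X →ₗ[A] (X × P) ⧸ G := G.mkQ.comp (LinearMap.inl A X P)
  let i : P →ₗ[A] (X × P) ⧸ G := G.mkQ.comp (LinearMap.inr A X P)
  let q : (X × P) ⧸ G →ₗ[A] N := G.liftQ (π.comp (LinearMap.snd A X P)) (by
    rintro _ ⟨k, rfl⟩
    simp [γ])
  have hqj : ∀ x, q (j x) = 0 := fun x => by simp [q, j]
  have hqi : ∀ p, q (i p) = π p := fun p => by simp [q, i]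
  have hik : ∀ k : LinearMap.ker π, i k = j (φ k) := fun k => by
    refine (Submodule.Quotient.eq G).2 ⟨-k, ?_⟩
    simp [γ]
  have hj : Function.Injective j := by
    refine (injective_iff_map_eq_zero j).2 fun x hx => ?_
    obtain ⟨k, hk⟩ := (hG _).1 ((Submodule.Quotient.mk_eq_zero G).1 hx)
    have h2 : k = 0 := by simpa [γ] using congrArg Prod.snd hk
    have h1 : φ k = x := congrArg Prod.fst hk
    rw [← h1, h2, map_zero]
  have hdecomp : ∀ z, ∃ x p, z = j x + i p := fun z => by
    obtain ⟨⟨x, p⟩, rfl⟩ := G.mkQ_surjective z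
    refine ⟨x, p, ?_⟩
    rw [LinearMap.comp_apply, LinearMap.comp_apply, ← map_add]
    simp
  have hq : Function.Surjective q := fun y => by
    obtain ⟨p, rfl⟩ := hπ y
    exact ⟨i p, hqi p⟩
  have hjq : LinearMap.range j = LinearMap.ker q := by
    ext z
    constructor
    · rintro ⟨x, rfl⟩
      exact hqj x
    · intro hz
      obtain ⟨x, p, rfl⟩ := hdecomp z
      rw [LinearMap.mem_ker, map_add, hqj, zero_add, hqi] at hz
      refine ⟨x + φ ⟨p, hz⟩, ?_⟩
      rw [map_add, ← hik]
  obtain ⟨s, hs⟩ := ha.exists_section hT hX (E := ModuleCat.of A ((X × P) ⧸ G)) j q hj hq hjq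
  have hmem : ∀ p, (i - s.comp π) p ∈ LinearMap.range j := fun p => by
    rw [hjq, LinearMap.mem_ker, LinearMap.sub_apply, map_sub, hqi, LinearMap.comp_apply]
    have : q (s (π p)) = π p := LinearMap.congr_fun hs (π p)
    rw [this, sub_self]
  let e := LinearEquiv.ofInjective j hj
  refine ⟨e.symm.toLinearMap.comp ((i - s.comp π).codRestrict _ hmem),
    LinearMap.ext fun k => hj ?_⟩
  rw [← hik k]
  refine (congrArg Subtype.val (e.apply_symm_apply ⟨_, hmem k⟩)).trans ?_
  have hk : π k = 0 := k.2
  simp [hk]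

theorem IsMinimalApprox.exists_comp_eq [IsNoetherianRing A] (hT : IsTorsionClass A T)
    (ha : IsMinimalApprox T N a) {P Q : Type} [AddCommGroup P] [Module A P]
    [Module.Projective A P] [AddCommGroup Q] [Module A Q] (π : P →ₗ[A] N)
    (hπ : Function.Surjective π) (p : Q →ₗ[A] LinearMap.ker π) (hp : Function.Surjective p)
    (hsup : ∀ R : Submodule A Q, R.map p = ⊤ → R = ⊤) {X : ModuleCat.{0} A} (hX : X ∈ T)
    (g : Q →ₗ[A] X) : ∃ f : P →ₗ[A] X, f.comp ((LinearMap.ker π).subtype.comp p) = g := by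
  let W := (LinearMap.ker p).map g
  have hW : LinearMap.ker p ≤ LinearMap.ker (W.mkQ.comp g) := fun x hx => by
    rw [LinearMap.mem_ker, LinearMap.comp_apply]
    exact (Submodule.Quotient.mk_eq_zero W).2 ⟨x, hx, rfl⟩
  obtain ⟨φ, hφp⟩ := LinearMap.exists_comp_eq_of_ker_le hp hW
  have hφ : ∀ x, φ (p x) = W.mkQ (g x) := LinearMap.congr_fun hφp
  obtain ⟨h, hh⟩ := ha.exists_extend hT π hπ (X := ModuleCat.of A (X ⧸ W))
    (hT.mem_of_surjective hX (X := ModuleCat.of A (X ⧸ W)) W.mkQ W.mkQ_surjective) φ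
  obtain ⟨f, hf⟩ := Module.projective_lifting_property W.mkQ h W.mkQ_surjective
  refine ⟨f, ?_⟩
  have hker : LinearMap.ker (g - f.comp ((LinearMap.ker π).subtype.comp p)) = ⊤ := by
    refine hsup _ (eq_top_iff.2 ?_)
    rintro c -
    obtain ⟨x, rfl⟩ := hp c
    have h1 : W.mkQ (g x - f (p x)) = 0 := by
      have h2 : W.mkQ (f (p x)) = h (p x) := LinearMap.congr_fun hf _
      have h3 : h (p x) = φ (p x) := LinearMap.congr_fun hh _
      rw [map_sub, h2, h3, hφ, sub_self]
    obtain ⟨l, hl, hlx⟩ := (Submodule.Quotient.mk_eq_zero W).1 h1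
    have hl0 : p l = 0 := hl
    refine ⟨x - l, ?_, by rw [map_sub, hl0, sub_zero]⟩
    simp [hl0, hlx]
  exact (sub_eq_zero.1 (LinearMap.ker_eq_top.1 hker)).symm

/-- A functorially finite torsion class is cut out by a difference of `Hom`-dimensions from two
projective modules. -/
theorem exists_homDim_separation (K : Type) [Field K] [Algebra K A] [FiniteDimensional K A]
    (hT : IsTorsionClass A T) {M : ModuleCat.{0} A} (hM : Module.Finite A M)
    (hTM : T = Fac A M) :
    ∃ P Q : ModuleCat.{0} A, (Module.Finite A P ∧ Module.Projective A P) ∧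
      (Module.Finite A Q ∧ Module.Projective A Q) ∧
      (∀ X ∈ T, Nontrivial X → homDim A K Q X < homDim A K P X) ∧
      ∀ Y : ModuleCat.{0} A, Module.Finite A Y →
        (∀ L : Submodule A Y, ModuleCat.of A L ∈ T → L = ⊥) →
        homDim A K P Y ≤ homDim A K Q Y := by
  have : IsArtinianRing A := isArtinian_of_tower K inferInstance
  have : IsNoetherianRing A := isNoetherian_of_tower K inferInstance
  obtain ⟨N, a, ha⟩ := exists_isMinimalApprox K hT hM hTM
  have hN : Module.Finite A N := hT.1 N ha.mem
  obtain ⟨m, π, hπ⟩ := Module.Finite.exists_fin' A N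
  obtain ⟨Q, p, hQ, hQp, hp, hsup⟩ := exists_projective_cover (A := A) (LinearMap.ker π)
  refine ⟨ModuleCat.of A (Fin m → A), Q, ⟨inferInstanceAs (Module.Finite A (Fin m → A)),
    inferInstanceAs (Module.Projective A (Fin m → A))⟩, ⟨hQ, hQp⟩, fun X hX hXn => ?_,
    fun Y hY hL => ?_⟩
  · have := hT.1 X hX
    refine homDim_lt_of_forall_exists_comp_eq K (Q := Fin m → A)
      ((LinearMap.ker π).subtype.comp p)
      (ha.exists_comp_eq hT π hπ p hp hsup hX) ?_
    obtain ⟨x, hx⟩ := exists_ne (0 : X)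
    obtain ⟨f, hf⟩ := ha.exists_apply_eq X hX x
    refine ⟨f.comp π, fun h0 => ?_, LinearMap.ext fun z => ?_⟩
    · obtain ⟨y, rfl⟩ := hπ a
      exact hx (hf ▸ LinearMap.congr_fun h0 y)
    · have hz : π (p z) = 0 := (p z).2
      simp [hz]
  · refine homDim_le_of_forall_comp_eq_zero K (Q := Fin m → A)
      ((LinearMap.ker π).subtype.comp p) fun f hf => ?_
    have hker : LinearMap.ker π ≤ LinearMap.ker f := fun x hx => by
      obtain ⟨z, hz⟩ := hp ⟨x, hx⟩
      have := LinearMap.congr_fun hf z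
      simpa [hz] using this
    obtain ⟨f', hf'⟩ := LinearMap.exists_comp_eq_of_ker_le hπ hker
    have h0 := hL (LinearMap.range f') (hT.mem_of_surjective ha.mem
      (X := ModuleCat.of A (LinearMap.range f')) f'.rangeRestrict
      (LinearMap.surjective_rangeRestrict _))
    rw [← hf', LinearMap.range_eq_bot.1 h0, LinearMap.zero_comp]

theorem IsTorsionClass.exists_maximal_submodule [IsNoetherianRing A] (hT : IsTorsionClass A T)
    (hne : T.Nonempty) (V : ModuleCat.{0} A) (hV : Module.Finite A V) :
    ∃ N : Submodule A V, ModuleCat.of A N ∈ T ∧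
      ∀ L : Submodule A (V ⧸ N), ModuleCat.of A L ∈ T → L = ⊥ := by
  obtain ⟨U, hU⟩ := hne
  have hbot : ModuleCat.of A (⊥ : Submodule A V) ∈ T :=
    hT.mem_of_surjective hU (X := ModuleCat.of A (⊥ : Submodule A V)) 0
      fun y => ⟨0, Subsingleton.elim (α := (⊥ : Submodule A V)) _ _⟩
  obtain ⟨N, hN, hmax⟩ := WellFounded.has_min (wellFounded_gt (α := Submodule A V))
    {N | ModuleCat.of A N ∈ T} ⟨⊥, hbot⟩
  refine ⟨N, hN, fun L hL => ?_⟩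
  let L' := L.comap N.mkQ
  have hle : N ≤ L' := fun x hx => by
    have : N.mkQ x = 0 := (Submodule.Quotient.mk_eq_zero N).2 hx
    rw [Submodule.mem_comap, this]
    exact L.zero_mem
  let g : L' →ₗ[A] L := N.mkQ.restrict fun x hx => hx
  have hL' : ModuleCat.of A L' ∈ T := by
    refine hT.2.2.2 (ModuleCat.of A N) (ModuleCat.of A L') (ModuleCat.of A L)
      (Submodule.inclusion hle) g (Submodule.inclusion_injective hle) ?_ ?_ hN hL
    · rintro ⟨y, hy⟩
      obtain ⟨x, rfl⟩ := N.mkQ_surjective y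
      exact ⟨⟨x, hy⟩, rfl⟩
    · ext x
      rw [Submodule.range_inclusion, LinearMap.mem_ker, Submodule.mem_comap,
        ← Submodule.Quotient.mk_eq_zero N, Subtype.ext_iff]
      rfl
  have heq : N = L' := (lt_or_eq_of_le hle).resolve_left (hmax _ hL')
  rw [eq_bot_iff]
  intro y hy
  obtain ⟨x, rfl⟩ := N.mkQ_surjective y
  exact (Submodule.Quotient.mk_eq_zero N).2 (heq ▸ hy)

end Torsion

section Newton

variable {n : ℕ} {S : Fin n → ModuleCat.{0} A}

theorem dimVec_of_subsingleton (X : Type) [AddCommGroup X] [Module A X] [Subsingleton X] :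
    dimVec A S X = 0 := by
  funext i
  rw [dimVec]
  split_ifs with h
  · have : IsEmpty (Fin h.choose.length) :=
      ⟨fun j => (h.choose.lt_succ j).ne (Subsingleton.elim _ _)⟩
    simp
  · rfl

theorem dimVec_ne_zero (K : Type) [Field K] [Algebra K A] [FiniteDimensional K A]
    (hdistinct : ∀ i j, Nonempty ((S i : Type) ≃ₗ[A] (S j : Type)) → i = j)
    (hcomplete : ∀ M : ModuleCat.{0} A, IsSimpleModule A M → ∃ i, Nonempty (M ≃ₗ[A] S i))
    (Y : Type) [AddCommGroup Y] [Module A Y] [Module.Finite A Y] [Nontrivial Y] :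
    dimVec A S Y ≠ 0 := by
  intro h0
  obtain ⟨y, hy⟩ := exists_ne (0 : Y)
  have hlt := homDim_lt_of_forall_exists_comp_eq K (P := PUnit) (X := Y) (0 : PUnit →ₗ[A] A)
    (fun g => ⟨0, LinearMap.ext fun x => by
      rw [Subsingleton.elim x 0, map_zero, map_zero]⟩)
    ⟨LinearMap.toSpanSingleton A Y y, fun h => hy (by simpa using LinearMap.congr_fun h 1),
      by simp⟩
  rw [homDim_eq_sum_dimVec K (P := A) hdistinct hcomplete, h0] at hlt
  simp at hlt

theorem convex_insert_zero_pos {E : Type*} [AddCommGroup E] [Module ℝ E] (θ : E →ₗ[ℝ] ℝ) :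
    Convex ℝ {v | v = 0 ∨ 0 < θ v} := by
  rw [convex_iff_forall_pos]
  rintro x (rfl | hx) y (rfl | hy) s t hs ht -
  · left; simp
  · right; simp only [smul_zero, zero_add, map_smul, smul_eq_mul]; positivity
  · right; simp only [smul_zero, add_zero, map_smul, smul_eq_mul]; positivity
  · right; simp only [map_add, map_smul, smul_eq_mul]; positivity

/-- Membership in a functorially finite torsion class is detected by the Newton polytope. -/
theorem mem_of_newtonPolytope_eq (K : Type) [Field K] [Algebra K A] [FiniteDimensional K A]
    (hdistinct : ∀ i j, Nonempty ((S i : Type) ≃ₗ[A] (S j : Type)) → i = j)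
    (hcomplete : ∀ M : ModuleCat.{0} A, IsSimpleModule A M → ∃ i, Nonempty (M ≃ₗ[A] S i))
    {T : Set (ModuleCat.{0} A)} (hT : IsTorsionClass A T) {M : ModuleCat.{0} A}
    (hM : Module.Finite A M) (hTM : T = Fac A M) {U V : ModuleCat.{0} A} (hU : U ∈ T)
    (hV : Module.Finite A V) (h : newtonPolytope A S U = newtonPolytope A S V) : V ∈ T := by
  have : IsNoetherianRing A := isNoetherian_of_tower K inferInstance
  obtain ⟨P, Q, ⟨hP, hPp⟩, ⟨hQ, hQp⟩, hpos, hnonpos⟩ := exists_homDim_separation K hT hM hTM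
  obtain ⟨N, hN, hmax⟩ := hT.exists_maximal_submodule ⟨U, hU⟩ V hV
  let θ : (Fin n → ℝ) →ₗ[ℝ] ℝ :=
    ∑ i, ((homDim A K P (S i) : ℝ) - homDim A K Q (S i)) • LinearMap.proj i
  let dimR (X : Type) [AddCommGroup X] [Module A X] : Fin n → ℝ := fun i => dimVec A S X i
  have hθ : ∀ (X : Type) [AddCommGroup X] [Module A X] [Module.Finite A X],
      θ (dimR X) = (homDim A K P X : ℝ) - homDim A K Q X := by
    intro X _ _ _
    rw [homDim_eq_sum_dimVec K (P := P) (X := X) hdistinct hcomplete,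
      homDim_eq_sum_dimVec K (P := Q) (X := X) hdistinct hcomplete]
    push_cast
    rw [← Finset.sum_sub_distrib, LinearMap.sum_apply]
    refine Finset.sum_congr rfl fun i _ => ?_
    simp only [LinearMap.smul_apply, LinearMap.proj_apply, smul_eq_mul, dimR]
    ring
  have hUfin : Module.Finite A U := hT.1 U hU
  have hsub : newtonPolytope A S U ⊆ {v | v = 0 ∨ 0 < θ v} := by
    refine convexHull_min ?_ (convex_insert_zero_pos θ)
    rintro _ ⟨p, rfl⟩
    change dimR (U ⧸ p) = 0 ∨ 0 < θ (dimR (U ⧸ p))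
    rw [hθ]
    have hmem : ModuleCat.of A (U ⧸ p) ∈ T :=
      hT.mem_of_surjective hU (X := ModuleCat.of A (U ⧸ p)) p.mkQ p.mkQ_surjective
    rcases subsingleton_or_nontrivial (U ⧸ p) with hs | hn
    · left
      funext i
      exact Nat.cast_eq_zero.2 (congrFun (dimVec_of_subsingleton (S := S) (U ⧸ p)) i)
    · right
      exact sub_pos.2 (Nat.cast_lt.2 (hpos _ hmem hn))
  by_contra hVT
  have hNtop : N ≠ ⊤ := by
    rintro rfl
    exact hVT (hT.mem_of_surjective hN (X := V) Submodule.topEquiv.toLinearMap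
      Submodule.topEquiv.surjective)
  have : Nontrivial (V ⧸ N) := Submodule.Quotient.nontrivial_iff.2 hNtop
  have hmem : dimR (V ⧸ N) ∈ newtonPolytope A S V := subset_convexHull _ _ ⟨N, rfl⟩
  rw [← h] at hmem
  rcases hsub hmem with h0 | h0
  · refine dimVec_ne_zero K hdistinct hcomplete (V ⧸ N) (funext fun i => ?_)
    exact Nat.cast_eq_zero.1 (congrFun h0 i)
  · rw [hθ] at h0
    have hle := hnonpos (ModuleCat.of A (V ⧸ N)) (inferInstanceAs (Module.Finite A (V ⧸ N))) hmax
    exact absurd (Nat.cast_lt.1 (sub_pos.1 h0)) (not_lt.2 hle)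

end Newton

end Helpers

/-- left finite bricks with the same Newton polytope are isomorphic. -/
theorem iso_of_leftFinite_brick_of_newtonPolytope_eq (A : Type) [Ring A]
    (K : Type) [Field K] [Algebra K A] [FiniteDimensional K A]
    (n : ℕ) (S : Fin n → ModuleCat.{0} A)
    (hsimple : ∀ i, IsSimpleModule A (S i))
    (hdistinct : ∀ i j, Nonempty ((S i : Type) ≃ₗ[A] (S j : Type)) → i = j)
    (hcomplete : ∀ M : ModuleCat.{0} A, IsSimpleModule A M → ∃ i, Nonempty (M ≃ₗ[A] S i))
    (U V : ModuleCat.{0} A) (hU : Module.Finite A U) (hV : Module.Finite A V)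
    (hUb : IsBrick A U) (hVb : IsBrick A V)
    (hUlf : LeftFinite A U) (hVlf : LeftFinite A V)
    (hNewton : newtonPolytope A S U = newtonPolytope A S V) :
    Nonempty (U ≃ₗ[A] V) := by
  have hUT : IsTorsionClass A (torsGen A U) :=
    isTorsionClass_torsGen_of_mem (isTorsionClass_hitByHom U) (mem_hitByHom_self U hU)
  have hVT : IsTorsionClass A (torsGen A V) :=
    isTorsionClass_torsGen_of_mem (isTorsionClass_hitByHom V) (mem_hitByHom_self V hV)
  obtain ⟨M, hM, hUM⟩ := hUlf
  obtain ⟨M', hM', hVM⟩ := hVlf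
  exact hUb.nonempty_equiv_of_mem_torsGen hU hV hVb
    (mem_of_newtonPolytope_eq K hdistinct hcomplete hUT hM hUM (mem_torsGen_self U) hV hNewton)
    (mem_of_newtonPolytope_eq K hdistinct hcomplete hVT hM' hVM (mem_torsGen_self V) hU
      hNewton.symm)
end

section
/- Let U and V be indecomposable τ-rigid modules in mod A with the same Newton polytope, N(U) = N(V). Then U and V are isomorphic. -/
/-! Common definitions: finite-dimensional modules over a finite-dimensional algebra,
quotient modules, dimension vectors via composition series, Newton polytopes,
torsion classes, `Fac`, τ-rigidity, bricks, etc. -/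

variable (A : Type) [Ring A]

section

variable {A}

theorem Fin.le_sum_of_le_add_succ {k : ℕ} (F : Fin (k + 1) → ℕ) (d : Fin k → ℕ)
    (hF : ∀ j : Fin k, F j.castSucc ≤ d j + F j.succ) (hlast : F (Fin.last k) = 0) :
    F 0 ≤ ∑ j, d j := by
  induction k with
  | zero => simpa using hlast.le
  | succ k ih =>
    rw [Fin.sum_univ_succ]
    have h0 := hF 0
    have := ih (fun j => F j.succ) (fun j => d j.succ)
      (fun j => by simpa using hF j.succ) (by simpa using hlast)
    simp only [Fin.castSucc_zero] at h0
    omega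

theorem Fin.eq_sum_of_eq_add_succ {k : ℕ} (F : Fin (k + 1) → ℕ) (d : Fin k → ℕ)
    (hF : ∀ j : Fin k, F j.castSucc = d j + F j.succ) (hlast : F (Fin.last k) = 0) :
    F 0 = ∑ j, d j := by
  induction k with
  | zero => simpa using hlast
  | succ k ih =>
    rw [Fin.sum_univ_succ]
    have h0 := hF 0
    have := ih (fun j => F j.succ) (fun j => d j.succ)
      (fun j => by simpa using hF j.succ) (by simpa using hlast)
    simp only [Fin.castSucc_zero] at h0
    omega

section Hom

open Module

variable (K : Type) [Field K] [Algebra K A]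
variable (W : Type) [AddCommGroup W] [Module A W]
variable {L M N X : Type} [AddCommGroup L] [Module A L] [Module K L] [IsScalarTower K A L]
  [AddCommGroup M] [Module A M] [Module K M] [IsScalarTower K A M]
  [AddCommGroup N] [Module A N] [Module K N] [IsScalarTower K A N]
  [AddCommGroup X] [Module A X] [Module K X] [IsScalarTower K A X]

theorem finrank_linearMap_congr_right (e : M ≃ₗ[A] N) :
    finrank K (W →ₗ[A] M) = finrank K (W →ₗ[A] N) :=
  LinearEquiv.finrank_eq <| LinearEquiv.ofLinearMap
    (LinearMap.compRight K e.toLinearMap) (LinearMap.compRight K e.symm.toLinearMap)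
    (by ext; simp) (by ext; simp)

variable [Module K W] [IsScalarTower K A W]

theorem finite_linearMap_of_finite [Module.Finite K W] [Module.Finite K M] :
    Module.Finite K (W →ₗ[A] M) :=
  Module.Finite.of_injective (LinearMap.restrictScalarsₗ K A W M K)
    (LinearMap.restrictScalars_injective K)

theorem finrank_linearMap_of_exact [Module.Finite K W] [Module.Finite K M]
    (i : L →ₗ[A] M) (g : M →ₗ[A] N) (hi : Function.Injective i)
    (hig : LinearMap.range i = LinearMap.ker g) :
    finrank K (W →ₗ[A] M) = finrank K (W →ₗ[A] L) +
      finrank K (LinearMap.range (LinearMap.compRight K g : (W →ₗ[A] M) →ₗ[K] _)) := by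
  have := finite_linearMap_of_finite K W (M := M) (A := A)
  rw [← LinearMap.finrank_range_add_finrank_ker
    (LinearMap.compRight K g : (W →ₗ[A] M) →ₗ[K] _), add_comm]
  congr 1
  have hker : LinearMap.ker (LinearMap.compRight K g : (W →ₗ[A] M) →ₗ[K] _) =
      LinearMap.range (LinearMap.compRight K i : (W →ₗ[A] L) →ₗ[K] _) := by
    ext h
    simp only [LinearMap.mem_ker, LinearMap.compRight_apply, LinearMap.mem_range]
    constructor
    · intro hh
      have hmem : ∀ w, h w ∈ LinearMap.range i := fun w => by
        rw [hig]; exact LinearMap.congr_fun hh w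
      refine ⟨(LinearEquiv.ofInjective i hi).symm.toLinearMap ∘ₗ h.codRestrict _ hmem, ?_⟩
      ext w
      simp
    · rintro ⟨h', rfl⟩
      ext w
      have : i (h' w) ∈ LinearMap.ker g := hig ▸ LinearMap.mem_range_self i _
      simpa using this
  rw [hker]
  refine LinearMap.finrank_range_of_inj ?_
  intro a b hab
  ext w
  exact hi (LinearMap.congr_fun hab w)

theorem finrank_linearMap_quotient [Module.Finite K W] [Module.Finite K X]
    {p q : Submodule A X} (hpq : p ≤ q) :
    finrank K (W →ₗ[A] X ⧸ p) = finrank K (W →ₗ[A] q ⧸ p.comap q.subtype) +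
      finrank K (LinearMap.range (LinearMap.compRight K (Submodule.factor hpq) :
        (W →ₗ[A] X ⧸ p) →ₗ[K] _)) := by
  refine finrank_linearMap_of_exact K W ((p.comap q.subtype).mapQ p q.subtype le_rfl) _ ?_ ?_
  · rw [← LinearMap.ker_eq_bot, Submodule.ker_mapQ, Submodule.mkQ_map_self]
  · rw [Submodule.range_mapQ, Submodule.factor, Submodule.ker_mapQ, Submodule.range_subtype,
      Submodule.comap_id]

theorem finrank_linearMap_quotient_le [Module.Finite K W] [Module.Finite K X]
    {p q : Submodule A X} (hpq : p ≤ q) :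
    finrank K (W →ₗ[A] X ⧸ p) ≤
      finrank K (W →ₗ[A] q ⧸ p.comap q.subtype) + finrank K (W →ₗ[A] X ⧸ q) := by
  have := finite_linearMap_of_finite K W (M := X ⧸ q) (A := A)
  rw [finrank_linearMap_quotient K W hpq]
  gcongr
  exact Submodule.finrank_le _

theorem finrank_linearMap_quotient_eq [Module.Finite K W] [Module.Finite K X]
    (hlift : ∀ (q : Submodule A X) (h : W →ₗ[A] X ⧸ q), ∃ h' : W →ₗ[A] X, q.mkQ ∘ₗ h' = h)
    {p q : Submodule A X} (hpq : p ≤ q) :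
    finrank K (W →ₗ[A] X ⧸ p) =
      finrank K (W →ₗ[A] q ⧸ p.comap q.subtype) + finrank K (W →ₗ[A] X ⧸ q) := by
  rw [finrank_linearMap_quotient K W hpq]
  congr 1
  refine (LinearEquiv.ofTop _ (LinearMap.range_eq_top.2 fun h => ?_)).finrank_eq
  obtain ⟨h', rfl⟩ := hlift q h
  exact ⟨p.mkQ ∘ₗ h', by ext; simp⟩

variable {n : ℕ} {S : Fin n → ModuleCat.{0} A}

/-- Summing a quantity attached to the simple factors of a suitable composition series is the same
as summing against the dimension vector. -/
theorem exists_compositionSeries_sum_eq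
    (hdistinct : ∀ i j, Nonempty ((S i : Type) ≃ₗ[A] (S j : Type)) → i = j)
    (hcomplete : ∀ M : ModuleCat.{0} A, IsSimpleModule A M → ∃ i, Nonempty (M ≃ₗ[A] S i))
    (X : Type) [AddCommGroup X] [Module A X] [IsNoetherian A X] [IsArtinian A X] :
    ∃ s : CompositionSeries (Submodule A X), s.head = ⊥ ∧ s.last = ⊤ ∧
      ∀ (d : Fin s.length → ℕ) (c : Fin n → ℕ),
        (∀ j i, Nonempty ((s j.succ ⧸ (s j.castSucc).comap (s j.succ).subtype) ≃ₗ[A] S i) →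
          d j = c i) →
        ∑ j, d j = ∑ i, dimVec A S X i * c i := by
  classical
  have h := exists_compositionSeries_of_isNoetherian_isArtinian A X
  refine ⟨h.choose, h.choose_spec.1, h.choose_spec.2, fun d c hdc => ?_⟩
  have hdim : ∀ i, dimVec A S X i = Nat.card {j : Fin h.choose.length //
      Nonempty ((↥(h.choose j.succ) ⧸ (Submodule.comap (h.choose j.succ).subtype
          (h.choose j.castSucc))) ≃ₗ[A] S i)} := fun i => dif_pos h
  simp only [hdim]
  generalize h.choose = s at d hdc ⊢
  have hs : ∀ j : Fin s.length, ∃ i,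
      Nonempty ((s j.succ ⧸ (s j.castSucc).comap (s j.succ).subtype) ≃ₗ[A] S i) := fun j => by
    have hc : s j.castSucc ⋖ s j.succ := s.step j
    exact hcomplete (ModuleCat.of A _) ((covBy_iff_quot_is_simple hc.le).mp hc)
  choose ι hι using hs
  have key : ∀ j i, Nonempty ((s j.succ ⧸ (s j.castSucc).comap (s j.succ).subtype) ≃ₗ[A] S i) ↔
      ι j = i := fun j i =>
    ⟨fun ⟨e⟩ => hdistinct _ _ ⟨(hι j).some.symm.trans e⟩, fun e => e ▸ hι j⟩
  simp only [key, Nat.card_eq_fintype_card, Fintype.card_subtype]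
  rw [← Finset.sum_fiberwise Finset.univ ι d]
  refine Finset.sum_congr rfl fun i _ => ?_
  rw [Finset.sum_congr rfl (g := fun _ => c i), Finset.sum_const, smul_eq_mul]
  intro j hj
  exact hdc j i ((key j i).2 (Finset.mem_filter.1 hj).2)

variable [∀ i, Module K (S i)] [∀ i, IsScalarTower K A (S i)]

theorem finrank_linearMap_le_sum_dimVec [Module.Finite K W] [Module.Finite K X]
    [IsNoetherian A X] [IsArtinian A X]
    (hdistinct : ∀ i j, Nonempty ((S i : Type) ≃ₗ[A] (S j : Type)) → i = j)
    (hcomplete : ∀ M : ModuleCat.{0} A, IsSimpleModule A M → ∃ i, Nonempty (M ≃ₗ[A] S i)) :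
    finrank K (W →ₗ[A] X) ≤ ∑ i, dimVec A S X i * finrank K (W →ₗ[A] S i) := by
  obtain ⟨s, h0, h1, hs⟩ := exists_compositionSeries_sum_eq hdistinct hcomplete X
  rw [← hs (fun j => finrank K (W →ₗ[A] s j.succ ⧸ (s j.castSucc).comap (s j.succ).subtype))
    _ fun j i ⟨e⟩ => finrank_linearMap_congr_right K W e,
    finrank_linearMap_congr_right K W (Submodule.quotEquivOfEqBot (s 0) h0).symm]
  refine Fin.le_sum_of_le_add_succ (fun j => finrank K (W →ₗ[A] X ⧸ s j)) _ (fun j => ?_) ?_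
  · exact finrank_linearMap_quotient_le K W (s.step j).le
  · have : Subsingleton (X ⧸ s (Fin.last _)) := Submodule.Quotient.subsingleton_iff.2 h1
    exact finrank_zero_of_subsingleton

theorem finrank_linearMap_eq_sum_dimVec [Module.Finite K W] [Module.Finite K X]
    [IsNoetherian A X] [IsArtinian A X]
    (hdistinct : ∀ i j, Nonempty ((S i : Type) ≃ₗ[A] (S j : Type)) → i = j)
    (hcomplete : ∀ M : ModuleCat.{0} A, IsSimpleModule A M → ∃ i, Nonempty (M ≃ₗ[A] S i))
    (hlift : ∀ (q : Submodule A X) (h : W →ₗ[A] X ⧸ q), ∃ h' : W →ₗ[A] X, q.mkQ ∘ₗ h' = h) :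
    finrank K (W →ₗ[A] X) = ∑ i, dimVec A S X i * finrank K (W →ₗ[A] S i) := by
  obtain ⟨s, h0, h1, hs⟩ := exists_compositionSeries_sum_eq hdistinct hcomplete X
  rw [← hs (fun j => finrank K (W →ₗ[A] s j.succ ⧸ (s j.castSucc).comap (s j.succ).subtype))
    _ fun j i ⟨e⟩ => finrank_linearMap_congr_right K W e,
    finrank_linearMap_congr_right K W (Submodule.quotEquivOfEqBot (s 0) h0).symm]
  refine Fin.eq_sum_of_eq_add_succ (fun j => finrank K (W →ₗ[A] X ⧸ s j)) _ (fun j => ?_) ?_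
  · exact finrank_linearMap_quotient_eq K W hlift (s.step j).le
  · have : Subsingleton (X ⧸ s (Fin.last _)) := Submodule.Quotient.subsingleton_iff.2 h1
    exact finrank_zero_of_subsingleton

end Hom

theorem mem_Fac_of_surjective {U X Y : ModuleCat.{0} A} (hX : X ∈ Fac A U) (f : X →ₗ[A] Y)
    (hf : Function.Surjective f) : Y ∈ Fac A U := by
  obtain ⟨k, g, hg⟩ := hX
  exact ⟨k, f ∘ₗ g, hf.comp hg⟩

theorem self_mem_Fac (U : ModuleCat.{0} A) : U ∈ Fac A U :=
  ⟨1, LinearMap.proj 0, fun u => ⟨fun _ => u, rfl⟩⟩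

theorem IsTauRigid.exists_extension {U : ModuleCat.{0} A} (hU : IsTauRigid A U)
    {X : ModuleCat.{0} A} (hX : X ∈ Fac A U) {P : Type} [AddCommGroup P] [Module A P]
    (π : P →ₗ[A] U) (hπ : Function.Surjective π) (h : LinearMap.ker π →ₗ[A] X) :
    ∃ h' : P →ₗ[A] X, h' ∘ₗ (LinearMap.ker π).subtype = h := by
  let R : Submodule A (X × P) := LinearMap.range (h.prod (-(LinearMap.ker π).subtype))
  have hR : ∀ w : LinearMap.ker π, (h w, -(w : P)) ∈ R := fun w => ⟨w, by simp⟩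
  let f : X →ₗ[A] (X × P) ⧸ R := R.mkQ ∘ₗ LinearMap.inl A X P
  let e : P →ₗ[A] (X × P) ⧸ R := R.mkQ ∘ₗ LinearMap.inr A X P
  let g : (X × P) ⧸ R →ₗ[A] U := R.liftQ (π ∘ₗ LinearMap.snd A X P) (by
    rintro _ ⟨w, rfl⟩
    simp)
  have hf : Function.Injective f := by
    rw [injective_iff_map_eq_zero]
    intro x hx
    obtain ⟨w, hw⟩ := (Submodule.Quotient.mk_eq_zero R).1 hx
    have h1 : h w = x := congrArg Prod.fst hw
    have h2 : -(w : P) = 0 := congrArg Prod.snd hw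
    have h3 : w = 0 := Subtype.ext (neg_eq_zero.1 h2)
    rw [← h1, h3, map_zero]
  have hge : ∀ p, g (e p) = π p := fun p => by simp [g, e]
  have hg : Function.Surjective g := fun u => by
    obtain ⟨p, rfl⟩ := hπ u
    exact ⟨e p, hge p⟩
  have hfg : LinearMap.range f = LinearMap.ker g := by
    apply le_antisymm
    · rintro _ ⟨x, rfl⟩
      simp [f, g]
    · intro y hy
      obtain ⟨⟨x, p⟩, rfl⟩ := R.mkQ_surjective y
      have hp : π p = 0 := by simpa [g] using hy
      refine ⟨x + h ⟨p, hp⟩, ?_⟩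
      change R.mkQ _ = R.mkQ _
      rw [← sub_eq_zero, ← map_sub]
      exact (Submodule.Quotient.mk_eq_zero R).2 (by simpa using hR ⟨p, hp⟩)
  obtain ⟨s, hs⟩ := hU X hX (ModuleCat.of A ((X × P) ⧸ R)) f g hf hg hfg
  have hs' : ∀ u, g (s u) = u := LinearMap.congr_fun hs
  have hmem : ∀ p, (e - s ∘ₗ π) p ∈ LinearMap.range f := fun p => by
    rw [hfg]
    change g (e p - s (π p)) = 0
    rw [map_sub, hge, hs', sub_self]
  refine ⟨(LinearEquiv.ofInjective f hf).symm.toLinearMap ∘ₗ (e - s ∘ₗ π).codRestrict _ hmem, ?_⟩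
  ext w
  apply hf
  have hw : π w = 0 := w.2
  have h1 := LinearEquiv.ofInjective_symm_apply (f := f) (h := hf) ⟨_, hmem w⟩
  refine h1.trans ?_
  change e w - s (π w) = f (h w)
  rw [hw, map_zero, sub_zero, ← sub_eq_zero]
  change R.mkQ _ - R.mkQ _ = 0
  rw [← map_sub]
  exact (Submodule.Quotient.mk_eq_zero R).2 (by simpa using R.neg_mem (hR w))

theorem IsTauRigid.exists_lift {U : ModuleCat.{0} A} (hU : IsTauRigid A U)
    {V : Type} [AddCommGroup V] [Module A V] (T : Submodule A V)
    (hT : ModuleCat.of A T ∈ Fac A U) (g : U →ₗ[A] V ⧸ T) :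
    ∃ g' : U →ₗ[A] V, T.mkQ ∘ₗ g' = g := by
  let E : Submodule A (V × U) :=
    LinearMap.ker (T.mkQ ∘ₗ LinearMap.fst A V U - g ∘ₗ LinearMap.snd A V U)
  have hE : ∀ x : V × U, x ∈ E ↔ T.mkQ x.1 = g x.2 := fun x => by
    simp [E, sub_eq_zero]
  let f : T →ₗ[A] E := (LinearMap.inl A V U ∘ₗ T.subtype).codRestrict E fun t => by
    simp [hE]
  let π : E →ₗ[A] U := LinearMap.snd A V U ∘ₗ E.subtype
  have hf : Function.Injective f := fun a b hab =>
    Subtype.ext (congrArg (fun x : E => x.1.1) hab)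
  have hπ : Function.Surjective π := fun u => by
    obtain ⟨v, hv⟩ := T.mkQ_surjective (g u)
    exact ⟨⟨(v, u), (hE _).2 hv⟩, rfl⟩
  have hfπ : LinearMap.range f = LinearMap.ker π := by
    apply le_antisymm
    · rintro _ ⟨t, rfl⟩
      rfl
    · rintro ⟨⟨v, u⟩, hx⟩ hu
      obtain rfl : u = 0 := hu
      have hv : v ∈ T := by simpa using (hE _).1 hx
      exact ⟨⟨v, hv⟩, rfl⟩
  obtain ⟨s, hs⟩ := hU _ hT (ModuleCat.of A E) f π hf hπ hfπ
  refine ⟨LinearMap.fst A V U ∘ₗ E.subtype ∘ₗ s, ?_⟩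
  ext u
  refine ((hE (s u).1).1 (s u).2).trans ?_
  exact congrArg g (LinearMap.congr_fun hs u)

/-- `V` has a submodule in `Fac U` whose quotient receives no nonzero map from `U`. -/
theorem IsTauRigid.exists_torsion_submodule {U : ModuleCat.{0} A} (hU : IsTauRigid A U)
    (V : Type) [AddCommGroup V] [Module A V] [IsNoetherian A V] :
    ∃ T : Submodule A V, ModuleCat.of A T ∈ Fac A U ∧ ∀ g : U →ₗ[A] V ⧸ T, g = 0 := by
  obtain ⟨T, ⟨k, f, hf⟩, hmax⟩ := set_has_maximal_iff_noetherian.2 ‹IsNoetherian A V›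
    {T | ∃ (k : ℕ) (f : (Fin k → U) →ₗ[A] V), LinearMap.range f = T}
    ⟨_, 0, 0, rfl⟩
  subst hf
  have hT : ModuleCat.of A (LinearMap.range f) ∈ Fac A U :=
    ⟨k, f.rangeRestrict, f.surjective_rangeRestrict⟩
  refine ⟨_, hT, fun g => ?_⟩
  obtain ⟨g', rfl⟩ := hU.exists_lift _ hT g
  let f' : (Fin (k + 1) → U) →ₗ[A] V :=
    f ∘ₗ LinearMap.funLeft A U Fin.succ + g' ∘ₗ LinearMap.proj 0
  have hf' : ∀ u x, f' (Fin.cons u x) = f x + g' u := fun u x => rfl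
  have hle : LinearMap.range f ≤ LinearMap.range f' := by
    rintro _ ⟨x, rfl⟩
    exact ⟨Fin.cons 0 x, by rw [hf', map_zero, add_zero]⟩
  have heq : LinearMap.range f = LinearMap.range f' :=
    (hle.lt_or_eq).resolve_left (hmax _ ⟨k + 1, f', rfl⟩)
  ext u
  refine (Submodule.Quotient.mk_eq_zero _).2 ?_
  rw [heq]
  exact ⟨Fin.cons u 0, by rw [hf', map_zero, zero_add]⟩

theorem Indecomposable.eq_bot_or_eq_bot_of_isCompl {M : ModuleCat.{0} A} (hM : Indecomposable A M)
    {p q : Submodule A M} (h : IsCompl p q) : p = ⊥ ∨ q = ⊥ := by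
  have := hM.2 (ModuleCat.of A p) (ModuleCat.of A q) ⟨(Submodule.prodEquivOfIsCompl p q h).symm⟩
  exact this.imp (fun h => (Submodule.subsingleton_iff_eq_bot).1 h)
    (fun h => (Submodule.subsingleton_iff_eq_bot).1 h)

/-- **Fitting's lemma** for indecomposable modules. -/
theorem Indecomposable.isNilpotent_or_bijective {M : ModuleCat.{0} A} (hM : Indecomposable A M)
    [IsNoetherian A M] [IsArtinian A M] (f : Module.End A M) :
    IsNilpotent f ∨ Function.Bijective f := by
  obtain ⟨k, hk, hk1⟩ := (f.eventually_isCompl_ker_pow_range_pow.and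
    (Filter.eventually_ge_atTop 1)).exists
  rcases hM.eq_bot_or_eq_bot_of_isCompl hk with h | h
  · right
    have hinj : Function.Injective f := by
      rw [← LinearMap.ker_eq_bot, eq_bot_iff, ← h]
      obtain ⟨m, rfl⟩ := Nat.exists_eq_add_of_le' hk1
      intro x hx
      rw [LinearMap.mem_ker, pow_succ, Module.End.mul_apply, LinearMap.mem_ker.1 hx, map_zero]
    exact ⟨hinj, IsArtinian.surjective_of_injective_endomorphism f hinj⟩
  · left
    exact ⟨k, LinearMap.range_eq_bot.1 h⟩

/-- If `β ∘ α` is bijective for maps `α : U → V` and `β : V → U` with `U` nonzero and `V`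
indecomposable, then `U` and `V` are isomorphic. -/
theorem Indecomposable.nonempty_equiv_of_bijective_comp {U V : ModuleCat.{0} A} [Nontrivial U]
    (hV : Indecomposable A V) (α : U →ₗ[A] V) (β : V →ₗ[A] U)
    (h : Function.Bijective (β ∘ₗ α)) : Nonempty (U ≃ₗ[A] V) := by
  have hα : Function.Injective α := Function.Injective.of_comp h.1
  have hcompl : IsCompl (LinearMap.range α) (LinearMap.ker β) := by
    constructor
    · rw [Submodule.disjoint_def]
      rintro _ ⟨u, rfl⟩ hu
      have : u = 0 := h.1 (by rw [map_zero]; exact hu)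
      rw [this, map_zero]
    · rw [codisjoint_iff, eq_top_iff]
      intro v _
      obtain ⟨u, hu⟩ := h.2 (β v)
      refine Submodule.mem_sup.2 ⟨α u, ⟨u, rfl⟩, v - α u, ?_, by abel⟩
      rw [LinearMap.mem_ker, map_sub, sub_eq_zero]
      exact hu.symm
  rcases hV.eq_bot_or_eq_bot_of_isCompl hcompl with hb | hb
  · exfalso
    obtain ⟨u, hu⟩ := exists_ne (0 : U)
    exact hu (hα (by rw [LinearMap.range_eq_bot.1 hb]; rfl))
  · refine ⟨LinearEquiv.ofBijective α ⟨hα, ?_⟩⟩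
    have := hcompl.sup_eq_top
    rwa [hb, sup_bot_eq, LinearMap.range_eq_top] at this

theorem Indecomposable.nonempty_equiv_of_mem_Fac {U V : ModuleCat.{0} A}
    [IsNoetherian A U] [IsArtinian A U] [Module.Finite (Module.End A U) U]
    (hU : Indecomposable A U) (hV : Indecomposable A V) (hUV : U ∈ Fac A V) (hVU : V ∈ Fac A U) :
    Nonempty (U ≃ₗ[A] V) := by
  have := hU.1
  obtain ⟨k, f, hf⟩ := hUV
  obtain ⟨m, g, hg⟩ := hVU
  by_contra hne
  have hJ : ∀ (α : U →ₗ[A] V) (β : V →ₗ[A] U),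
      (β ∘ₗ α : Module.End A U) ∈ Ring.jacobson (Module.End A U) := by
    intro α β
    rw [← Ideal.jacobson_bot, Ideal.mem_jacobson_iff]
    intro y
    have hnil : IsNilpotent (y * (β ∘ₗ α : Module.End A U)) :=
      (hU.isNilpotent_or_bijective _).resolve_right fun hb =>
        hne (hV.nonempty_equiv_of_bijective_comp α (y ∘ₗ β) hb)
    obtain ⟨z, hz⟩ := hnil.isUnit_one_add.exists_left_inv
    refine ⟨z, ?_⟩
    rw [Submodule.mem_bot, sub_eq_zero, ← hz, mul_add, mul_one, mul_assoc, add_comm]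
  have hmem : ∀ (α : U →ₗ[A] V) (β : V →ₗ[A] U) (u : U),
      β (α u) ∈ Ring.jacobson (Module.End A U) • (⊤ : Submodule (Module.End A U) U) :=
    fun α β u => Submodule.smul_mem_smul (hJ α β) (Submodule.mem_top (x := u))
  refine (Submodule.jacobson_smul_lt_top (R := Module.End A U) (M := U) ⊤).not_ge fun u _ => ?_
  obtain ⟨v, rfl⟩ := hf u
  rw [← LinearMap.sum_single_apply (fun _ => V) v, map_sum]
  refine Submodule.sum_mem _ fun j _ => ?_
  obtain ⟨w, hw⟩ := hg (v j)
  rw [← hw, ← LinearMap.sum_single_apply (fun _ => U) w, map_sum,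
    ← LinearMap.coe_single A (fun _ => V) j, map_sum, map_sum]
  exact Submodule.sum_mem _ fun l _ =>
    hmem (g ∘ₗ LinearMap.single A (fun _ => U) l) (f ∘ₗ LinearMap.single A (fun _ => V) j) (w l)

section Hom

open Module

variable (K : Type) [Field K] [Algebra K A]

theorem finrank_linearMap_of_surjective
    {U P X : Type} [AddCommGroup U] [Module A U]
    [AddCommGroup P] [Module A P] [Module K P] [IsScalarTower K A P] [Module.Finite K P]
    [AddCommGroup X] [Module A X] [Module K X] [IsScalarTower K A X] [Module.Finite K X]
    (π : P →ₗ[A] U) (hπ : Function.Surjective π) :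
    finrank K (P →ₗ[A] X) = finrank K (U →ₗ[A] X) + finrank K (LinearMap.range
      (LinearMap.lcomp K X (LinearMap.ker π).subtype : (P →ₗ[A] X) →ₗ[K] _)) := by
  have := finite_linearMap_of_finite K P (M := X) (A := A)
  rw [← LinearMap.finrank_range_add_finrank_ker
    (LinearMap.lcomp K X (LinearMap.ker π).subtype : (P →ₗ[A] X) →ₗ[K] _), add_comm]
  congr 1
  have hker : LinearMap.ker (LinearMap.lcomp K X (LinearMap.ker π).subtype :
      (P →ₗ[A] X) →ₗ[K] _) =
      LinearMap.range (LinearMap.lcomp K X π : (U →ₗ[A] X) →ₗ[K] _) := by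
    ext h
    simp only [LinearMap.mem_ker, LinearMap.mem_range]
    constructor
    · intro hh
      have hle : LinearMap.ker π ≤ LinearMap.ker h := fun w hw =>
        LinearMap.congr_fun hh (⟨w, hw⟩ : LinearMap.ker π)
      refine ⟨(LinearMap.ker π).liftQ h hle ∘ₗ
        (π.quotKerEquivOfSurjective hπ).symm.toLinearMap, ?_⟩
      ext w
      have : (π.quotKerEquivOfSurjective hπ).symm (π w) = (LinearMap.ker π).mkQ w := by
        rw [LinearEquiv.symm_apply_eq]; rfl
      change (LinearMap.ker π).liftQ h hle ((π.quotKerEquivOfSurjective hπ).symm (π w)) = h w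
      rw [this]
      exact Submodule.liftQ_apply _ _ _
    · rintro ⟨h', rfl⟩
      ext w
      change h' (π w) = 0
      rw [LinearMap.mem_ker.1 w.2, map_zero]
  rw [hker]
  refine LinearMap.finrank_range_of_inj fun a b hab => ?_
  ext u
  obtain ⟨p, rfl⟩ := hπ u
  exact LinearMap.congr_fun hab p

theorem finrank_linearMap_le_add_ker
    {U P X : Type} [AddCommGroup U] [Module A U]
    [AddCommGroup P] [Module A P] [Module K P] [IsScalarTower K A P] [Module.Finite K P]
    [AddCommGroup X] [Module A X] [Module K X] [IsScalarTower K A X] [Module.Finite K X]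
    (π : P →ₗ[A] U) (hπ : Function.Surjective π) :
    finrank K (P →ₗ[A] X) ≤
      finrank K (U →ₗ[A] X) + finrank K (LinearMap.ker π →ₗ[A] X) := by
  have : Module.Finite K (LinearMap.ker π) :=
    inferInstanceAs (Module.Finite K ((LinearMap.ker π).restrictScalars K))
  have := finite_linearMap_of_finite K (LinearMap.ker π) (M := X) (A := A)
  rw [finrank_linearMap_of_surjective K π hπ]
  gcongr
  exact Submodule.finrank_le _

theorem IsTauRigid.finrank_linearMap_eq_add_ker {U : ModuleCat.{0} A} (hU : IsTauRigid A U)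
    {P : Type} [AddCommGroup P] [Module A P] [Module K P] [IsScalarTower K A P]
    [Module.Finite K P]
    {X : Type} [AddCommGroup X] [Module A X] [Module K X] [IsScalarTower K A X]
    [Module.Finite K X] (hX : ModuleCat.of A X ∈ Fac A U)
    (π : P →ₗ[A] U) (hπ : Function.Surjective π) :
    finrank K (P →ₗ[A] X) =
      finrank K (U →ₗ[A] X) + finrank K (LinearMap.ker π →ₗ[A] X) := by
  rw [finrank_linearMap_of_surjective K π hπ]
  congr 1
  refine (LinearEquiv.ofTop _ (LinearMap.range_eq_top.2 fun h => ?_)).finrank_eq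
  exact hU.exists_extension hX π hπ h

theorem IsTauRigid.exists_lift_ker {U : ModuleCat.{0} A} (hU : IsTauRigid A U)
    {P : Type} [AddCommGroup P] [Module A P] [Module.Projective A P]
    {X : Type} [AddCommGroup X] [Module A X] (hX : ModuleCat.of A X ∈ Fac A U)
    (π : P →ₗ[A] U) (hπ : Function.Surjective π)
    (q : Submodule A X) (h : LinearMap.ker π →ₗ[A] X ⧸ q) :
    ∃ h' : LinearMap.ker π →ₗ[A] X, q.mkQ ∘ₗ h' = h := by
  have hXq : ModuleCat.of A (X ⧸ q) ∈ Fac A U := mem_Fac_of_surjective hX q.mkQ q.mkQ_surjective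
  obtain ⟨e, rfl⟩ := hU.exists_extension hXq π hπ h
  obtain ⟨e', rfl⟩ := Module.projective_lifting_property q.mkQ e q.mkQ_surjective
  exact ⟨e' ∘ₗ (LinearMap.ker π).subtype, rfl⟩

variable [FiniteDimensional K A] {n : ℕ} {S : Fin n → ModuleCat.{0} A}
  [∀ i, Module K (S i)] [∀ i, IsScalarTower K A (S i)]

/-- If the Newton polytope of `V` is contained in that of a τ-rigid `U`, then every quotient `V ⧸ T`
without nonzero maps from `U` is zero. -/
theorem IsTauRigid.eq_top_of_newtonPolytope_le
    (hdistinct : ∀ i j, Nonempty ((S i : Type) ≃ₗ[A] (S j : Type)) → i = j)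
    (hcomplete : ∀ M : ModuleCat.{0} A, IsSimpleModule A M → ∃ i, Nonempty (M ≃ₗ[A] S i))
    {U V : ModuleCat.{0} A} [Module K U] [IsScalarTower K A U] [Module.Finite K U]
    [Module K V] [IsScalarTower K A V] [Module.Finite K V]
    (hU : IsTauRigid A U) (hNewton : newtonPolytope A S V ⊆ newtonPolytope A S U)
    (T : Submodule A V) (hT : ∀ g : U →ₗ[A] V ⧸ T, g = 0) : T = ⊤ := by
  have : Module.Finite A U := Module.Finite.of_restrictScalars_finite K A U
  have : Module.Finite A V := Module.Finite.of_restrictScalars_finite K A V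
  have : IsArtinianRing A := IsArtinianRing.of_finite K A
  obtain ⟨m, π, hπ⟩ := Module.Finite.exists_fin' A U
  have : Module.Finite K (LinearMap.ker π) :=
    inferInstanceAs (Module.Finite K ((LinearMap.ker π).restrictScalars K))
  let θ : Fin n → ℝ := fun i => finrank K U *
    (finrank K ((Fin m → A) →ₗ[A] S i) - finrank K (LinearMap.ker π →ₗ[A] S i)) -
      finrank K (A →ₗ[A] S i)
  let Θ : (Fin n → ℝ) →ₗ[ℝ] ℝ := ∑ i, θ i • LinearMap.proj i
  have hΘ : ∀ (X : Type) [AddCommGroup X] [Module A X],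
      Θ (fun i => (dimVec A S X i : ℝ)) = finrank K U *
        ((∑ i, dimVec A S X i * finrank K ((Fin m → A) →ₗ[A] S i) : ℕ) -
          (∑ i, dimVec A S X i * finrank K (LinearMap.ker π →ₗ[A] S i) : ℕ)) -
        (∑ i, dimVec A S X i * finrank K (A →ₗ[A] S i) : ℕ) := by
    intro X _ _
    simp only [Θ, θ, LinearMap.sum_apply, LinearMap.smul_apply, LinearMap.proj_apply, smul_eq_mul,
      Nat.cast_sum, Nat.cast_mul, ← Finset.sum_sub_distrib, Finset.mul_sum]
    exact Finset.sum_congr rfl fun i _ => by ring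
  have hproj : ∀ (X : Type) [AddCommGroup X] [Module A X] [Module K X] [IsScalarTower K A X]
      [Module.Finite K X] (P : Type) [AddCommGroup P] [Module A P] [Module K P]
      [IsScalarTower K A P] [Module.Finite K P] [Module.Projective A P],
      ∑ i, dimVec A S X i * finrank K (P →ₗ[A] S i) = finrank K (P →ₗ[A] X) := by
    intro X _ _ _ _ _ P _ _ _ _ _ _
    have : Module.Finite A X := Module.Finite.of_restrictScalars_finite K A X
    exact (finrank_linearMap_eq_sum_dimVec K P hdistinct hcomplete fun q h =>
      Module.projective_lifting_property q.mkQ h q.mkQ_surjective).symm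
  have hring : ∀ (X : Type) [AddCommGroup X] [Module A X] [Module K X] [IsScalarTower K A X],
      finrank K (A →ₗ[A] X) = finrank K X := fun X _ _ _ _ =>
    (LinearMap.ringLmapEquivSelf A K X).finrank_eq
  have hnonneg : newtonPolytope A S U ⊆ {v | 0 ≤ Θ v} := by
    refine convexHull_min ?_ (convex_halfSpace_ge Θ.isLinear 0)
    rintro _ ⟨p, rfl⟩
    have hfac : ModuleCat.of A (U ⧸ p) ∈ Fac A U :=
      mem_Fac_of_surjective (self_mem_Fac U) p.mkQ p.mkQ_surjective
    change 0 ≤ Θ _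
    rw [hΘ, hproj _ (Fin m → A), hproj _ A, hring,
      ← finrank_linearMap_eq_sum_dimVec K (LinearMap.ker π) hdistinct hcomplete (hU.exists_lift_ker hfac π hπ),
      hU.finrank_linearMap_eq_add_ker K hfac π hπ]
    have hle : finrank K (U ⧸ p) ≤ finrank K U * finrank K (U →ₗ[A] U ⧸ p) := by
      by_cases hp : p = ⊤
      · have := Submodule.Quotient.subsingleton_iff.2 hp
        rw [finrank_zero_of_subsingleton]
        exact Nat.zero_le _
      · have := finite_linearMap_of_finite K U (M := U ⧸ p) (A := A)
        have hpos : 0 < finrank K (U →ₗ[A] U ⧸ p) := by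
          have : Nontrivial (U →ₗ[A] U ⧸ p) :=
            ⟨p.mkQ, 0, fun h => hp (by rw [← p.ker_mkQ, h, LinearMap.ker_zero])⟩
          exact finrank_pos
        calc finrank K (U ⧸ p) ≤ finrank K U :=
              (p.mkQ.restrictScalars K).finrank_le_finrank_of_surjective p.mkQ_surjective
          _ ≤ _ := Nat.le_mul_of_pos_right _ hpos
    have : (finrank K (U ⧸ p) : ℝ) ≤ finrank K U * finrank K (U →ₗ[A] U ⧸ p) := by
      exact_mod_cast hle
    push_cast
    linarith
  have hV : 0 ≤ Θ (fun i => (dimVec A S (V ⧸ T) i : ℝ)) :=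
    hnonneg (hNewton (subset_convexHull ℝ _ ⟨T, rfl⟩))
  rw [hΘ, hproj _ (Fin m → A), hproj _ A, hring] at hV
  have hzero : finrank K (U →ₗ[A] V ⧸ T) = 0 := by
    have : Subsingleton (U →ₗ[A] V ⧸ T) := ⟨fun a b => (hT a).trans (hT b).symm⟩
    exact finrank_zero_of_subsingleton
  have h1 := finrank_linearMap_le_add_ker K (X := V ⧸ T) π hπ
  have h2 := finrank_linearMap_le_sum_dimVec K (LinearMap.ker π) (X := V ⧸ T) hdistinct hcomplete
  have h3 : (finrank K ((Fin m → A) →ₗ[A] V ⧸ T) : ℝ) ≤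
      (∑ i, dimVec A S (V ⧸ T) i * finrank K (LinearMap.ker π →ₗ[A] S i) : ℕ) := by
    exact_mod_cast h1.trans (by omega)
  have h4 : (finrank K (V ⧸ T) : ℝ) ≤ 0 := by
    have := mul_nonneg (Nat.cast_nonneg (α := ℝ) (finrank K U)) (sub_nonneg.2 h3)
    linarith
  have h5 : finrank K (V ⧸ T) = 0 := by exact_mod_cast h4.antisymm (Nat.cast_nonneg _)
  have := finrank_zero_iff.1 h5
  exact Submodule.Quotient.subsingleton_iff.1 this

theorem IsTauRigid.mem_Fac_of_newtonPolytope_le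
    (hdistinct : ∀ i j, Nonempty ((S i : Type) ≃ₗ[A] (S j : Type)) → i = j)
    (hcomplete : ∀ M : ModuleCat.{0} A, IsSimpleModule A M → ∃ i, Nonempty (M ≃ₗ[A] S i))
    {U V : ModuleCat.{0} A} [Module K U] [IsScalarTower K A U] [Module.Finite K U]
    [Module K V] [IsScalarTower K A V] [Module.Finite K V]
    (hU : IsTauRigid A U) (hNewton : newtonPolytope A S V ⊆ newtonPolytope A S U) :
    V ∈ Fac A U := by
  have : Module.Finite A V := Module.Finite.of_restrictScalars_finite K A V
  have : IsArtinianRing A := IsArtinianRing.of_finite K A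
  obtain ⟨T, hT, hT0⟩ := hU.exists_torsion_submodule V
  have htop := hU.eq_top_of_newtonPolytope_le K hdistinct hcomplete hNewton T hT0
  exact mem_Fac_of_surjective hT T.subtype fun v => ⟨⟨v, htop ▸ trivial⟩, rfl⟩

end Hom

end

/-- indecomposable τ-rigid modules with the same Newton polytope are
isomorphic. -/
theorem iso_of_indec_tauRigid_of_newtonPolytope_eq (A : Type) [Ring A]
    (K : Type) [Field K] [Algebra K A] [FiniteDimensional K A]
    (n : ℕ) (S : Fin n → ModuleCat.{0} A)
    (hsimple : ∀ i, IsSimpleModule A (S i))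
    (hdistinct : ∀ i j, Nonempty ((S i : Type) ≃ₗ[A] (S j : Type)) → i = j)
    (hcomplete : ∀ M : ModuleCat.{0} A, IsSimpleModule A M → ∃ i, Nonempty (M ≃ₗ[A] S i))
    (U V : ModuleCat.{0} A) (hU : Module.Finite A U) (hV : Module.Finite A V)
    (hUind : Indecomposable A U) (hVind : Indecomposable A V)
    (hUr : IsTauRigid A U) (hVr : IsTauRigid A V)
    (hNewton : newtonPolytope A S U = newtonPolytope A S V) :
    Nonempty (U ≃ₗ[A] V) := by
  let instK : ∀ M : ModuleCat.{0} A, Module K M := fun M => Module.restrictScalars K A M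
  have instT : ∀ M : ModuleCat.{0} A, IsScalarTower K A M :=
    fun M => IsScalarTower.restrictScalars K A M
  have : Module.Finite K U := Module.Finite.trans A U
  have : Module.Finite K V := Module.Finite.trans A V
  have : IsArtinianRing A := IsArtinianRing.of_finite K A
  have : Module.Finite (Module.End A U) U :=
    Module.Finite.of_restrictScalars_finite K (Module.End A U) U
  exact hUind.nonempty_equiv_of_mem_Fac hVind
    (hVr.mem_Fac_of_newtonPolytope_le K hdistinct hcomplete hNewton.le)
    (hUr.mem_Fac_of_newtonPolytope_le K hdistinct hcomplete hNewton.ge)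
end
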